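/- Let Ω ⊆ ℂⁿ be a pseudoconvex domain (nonempty, open, connected, admitting a smooth plurisubharmonic exhaustion function), and suppose there exist a real-valued function ψ, twice continuously differentiable on Ω, and constants D, E > 0 such that |⟨∂ψ(z), ξ⟩|² ≤ D²·Hψ(z; ξ) and Hψ(z; ξ) ≥ E|ξ|² for all z ∈ Ω and ξ ∈ ℂⁿ. Then ∂̄ has closed range: R(∂̄) = {α ∈ (L²(Ω))ⁿ : ∃u ∈ L²(Ω) with ∂̄u = α distributionally on Ω} is closed in (L²(Ω))ⁿ. -/

import Mathlib

open MeasureTheory Complex Metric Set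

noncomputable section

/-- The Wirtinger derivative `∂φ/∂z̄_j` of `φ : ℂⁿ → ℂ`:
`(1/2)(Dφ_z(e_j) + i·Dφ_z(i·e_j))`. -/
def dbarCoord (n : ℕ) (φ : (Fin n → ℂ) → ℂ) (j : Fin n) (z : Fin n → ℂ) : ℂ :=
  (1 / 2) * (fderiv ℝ φ z (Pi.single j 1) + Complex.I * fderiv ℝ φ z (Pi.single j Complex.I))

/-- A test function on `Ω`: smooth with compact support contained in `Ω`. -/
def IsTest (n : ℕ) (Ω : Set (Fin n → ℂ)) (φ : (Fin n → ℂ) → ℂ) : Prop :=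
  ContDiff ℝ (⊤ : ℕ∞) φ ∧ HasCompactSupport φ ∧ tsupport φ ⊆ Ω

/-- `∂̄u = α` distributionally on `Ω`. -/
def DbarEq (n : ℕ) (Ω : Set (Fin n → ℂ)) (u : (Fin n → ℂ) → ℂ)
    (α : Fin n → (Fin n → ℂ) → ℂ) : Prop :=
  ∀ j : Fin n, ∀ φ : (Fin n → ℂ) → ℂ, IsTest n Ω φ →
    ∫ z in Ω, α j z * φ z = - ∫ z in Ω, u z * dbarCoord n φ j z

/-- `α` is `∂̄`-closed on `Ω`. -/
def DbarClosed (n : ℕ) (Ω : Set (Fin n → ℂ)) (α : Fin n → (Fin n → ℂ) → ℂ) : Prop :=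
  ∀ j k : Fin n, ∀ φ : (Fin n → ℂ) → ℂ, IsTest n Ω φ →
    ∫ z in Ω, α j z * dbarCoord n φ k z = ∫ z in Ω, α k z * dbarCoord n φ j z

/-- The complex Hessian `Hf(z;ξ) = (1/4)(D²f_z(ξ,ξ) + D²f_z(iξ,iξ))`. -/
def hessC (n : ℕ) (f : (Fin n → ℂ) → ℝ) (z ξ : Fin n → ℂ) : ℝ :=
  (1 / 4) * (iteratedFDeriv ℝ 2 f z ![ξ, ξ]
    + iteratedFDeriv ℝ 2 f z ![Complex.I • ξ, Complex.I • ξ])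

/-- The pairing `⟨∂f(z), ξ⟩ = (1/2)(Df_z(ξ) − i·Df_z(iξ))`. -/
def delPair (n : ℕ) (f : (Fin n → ℂ) → ℝ) (z ξ : Fin n → ℂ) : ℂ :=
  (1 / 2) * ((fderiv ℝ f z ξ : ℂ) - Complex.I * (fderiv ℝ f z (Complex.I • ξ) : ℂ))

/-- Squared Euclidean norm of `ξ ∈ ℂⁿ`. -/
def enormSq (n : ℕ) (ξ : Fin n → ℂ) : ℝ := ∑ j, Complex.normSq (ξ j)

/-- The twisted curvature expression
`Θ_{λ,τ}(z;ξ) = τ(z)·Hλ(z;ξ) − Hτ(z;ξ) − τ(z)⁻¹·|⟨∂τ(z),ξ⟩|²`. -/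
def Theta (n : ℕ) (lam tau : (Fin n → ℂ) → ℝ) (z ξ : Fin n → ℂ) : ℝ :=
  tau z * hessC n lam z ξ - hessC n tau z ξ - (tau z)⁻¹ * Complex.normSq (delPair n tau z ξ)

/-- `Φ` is an exhaustion function of `Ω`: every sublevel set has compact closure inside `Ω`. -/
def ExhaustsOn (n : ℕ) (Ω : Set (Fin n → ℂ)) (Φ : (Fin n → ℂ) → ℝ) : Prop :=
  ∀ c : ℝ, IsCompact (closure {z ∈ Ω | Φ z < c}) ∧ closure {z ∈ Ω | Φ z < c} ⊆ Ω

/-- `Ω` is pseudoconvex: it admits a smooth plurisubharmonic exhaustion function. -/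
def Pseudoconvex (n : ℕ) (Ω : Set (Fin n → ℂ)) : Prop :=
  ∃ Φ : (Fin n → ℂ) → ℝ, ContDiffOn ℝ (⊤ : ℕ∞) Φ Ω ∧ (∀ z ∈ Ω, ∀ ξ, 0 ≤ hessC n Φ z ξ) ∧
    ExhaustsOn n Ω Φ

/-- `r` is a smooth defining function for `Ω` which is Levi pseudoconvex. -/
def IsLeviDefiningFn (n : ℕ) (Ω : Set (Fin n → ℂ)) (r : (Fin n → ℂ) → ℝ) : Prop :=
  ContDiff ℝ (⊤ : ℕ∞) r ∧ Ω = {z | r z < 0} ∧ (∀ z, r z = 0 → fderiv ℝ r z ≠ 0) ∧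
    (∀ p, r p = 0 → ∀ ξ, delPair n r p ξ = 0 → 0 ≤ hessC n r p ξ)


/-- The first-order operator `(1/2)(D F_z(e_j) + c·D F_z(i·e_j))`: it is `∂/∂z̄_j` for `c = i`
and `∂/∂z_j` for `c = -i`. -/
def wd (n : ℕ) (c : ℂ) (j : Fin n) (F : (Fin n → ℂ) → ℂ) (z : Fin n → ℂ) : ℂ :=
  (1 / 2) * (fderiv ℝ F z (Pi.single j 1) + c * fderiv ℝ F z (Pi.single j Complex.I))

section Wirtinger

variable {n : ℕ} {c d : ℂ} {j k : Fin n} {F G : (Fin n → ℂ) → ℂ} {z : Fin n → ℂ}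

lemma wd_congr (h : F =ᶠ[nhds z] G) : wd n c j F z = wd n c j G z := by
  simp only [wd, h.fderiv_eq]

lemma wd_const (a : ℂ) : wd n c j (fun _ => a) z = 0 := by
  simp [wd]

lemma wd_add (hF : DifferentiableAt ℝ F z) (hG : DifferentiableAt ℝ G z) :
    wd n c j (fun x => F x + G x) z = wd n c j F z + wd n c j G z := by
  simp only [wd, fderiv_fun_add hF hG, _root_.add_apply]; ring

lemma wd_sub (hF : DifferentiableAt ℝ F z) (hG : DifferentiableAt ℝ G z) :
    wd n c j (fun x => F x - G x) z = wd n c j F z - wd n c j G z := by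
  simp only [wd, fderiv_fun_sub hF hG, _root_.sub_apply]; ring

lemma wd_neg : wd n c j (fun x => - F x) z = - wd n c j F z := by
  simp only [wd, fderiv_fun_neg, _root_.neg_apply]; ring

lemma wd_mul (hF : DifferentiableAt ℝ F z) (hG : DifferentiableAt ℝ G z) :
    wd n c j (fun x => F x * G x) z = wd n c j F z * G z + F z * wd n c j G z := by
  simp only [wd, fderiv_fun_mul hF hG, _root_.add_apply,
    _root_.smul_apply, smul_eq_mul]; ring

lemma wd_const_mul (a : ℂ) (hF : DifferentiableAt ℝ F z) :
    wd n c j (fun x => a * F x) z = a * wd n c j F z := by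
  rw [wd_mul (differentiableAt_const a) hF, wd_const]; ring

lemma wd_exp (hF : DifferentiableAt ℝ F z) :
    wd n c j (fun x => Complex.exp (F x)) z = Complex.exp (F z) * wd n c j F z := by
  simp only [wd, hF.hasFDerivAt.cexp.fderiv, _root_.smul_apply, smul_eq_mul]; ring

lemma wd_star (hF : DifferentiableAt ℝ F z) :
    wd n c j (fun x => (starRingEnd ℂ) (F x)) z
      = (starRingEnd ℂ) (wd n ((starRingEnd ℂ) c) j F z) := by
  have h : HasFDerivAt (fun x => (starRingEnd ℂ) (F x))
      ((Complex.conjCLE : ℂ →L[ℝ] ℂ).comp (fderiv ℝ F z)) z :=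
    (Complex.conjCLE : ℂ →L[ℝ] ℂ).hasFDerivAt.comp z hF.hasFDerivAt
  simp [wd, h.fderiv, Complex.conj_ofNat]

lemma contDiff_wd {m m' : WithTop ℕ∞} (hF : ContDiff ℝ m' F) (h : m + 1 ≤ m') :
    ContDiff ℝ m (wd n c j F) := by
  have h1 : ContDiff ℝ m (fderiv ℝ F) := hF.fderiv_right h
  unfold wd
  fun_prop

lemma wd_comm (hF : ContDiff ℝ 2 F) :
    wd n c j (wd n d k F) z = wd n d k (wd n c j F) z := by
  have h1 : Differentiable ℝ (fderiv ℝ F) :=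
    (hF.fderiv_right (m := 1) (by norm_num)).differentiable one_ne_zero
  have h2 : IsSymmSndFDerivAt ℝ F z := hF.contDiffAt.isSymmSndFDerivAt (by simp)
  have h3 : ∀ (e : ℂ) (l : Fin n) (v : Fin n → ℂ), fderiv ℝ (wd n e l F) z v
      = (1 / 2) * (fderiv ℝ (fderiv ℝ F) z v (Pi.single l 1)
        + e * fderiv ℝ (fderiv ℝ F) z v (Pi.single l Complex.I)) := by
    intro e l v
    have h4 : ∀ w : Fin n → ℂ, HasFDerivAt (fun x => fderiv ℝ F x w)
        ((fderiv ℝ (fderiv ℝ F) z).flip w) z := fun w => by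
      simpa using! (h1 z).hasFDerivAt.clm_apply (hasFDerivAt_const w z)
    have h5 := ((h4 (Pi.single l 1)).add ((h4 (Pi.single l Complex.I)).const_mul e)).const_mul
      (1 / 2 : ℂ)
    have h6 : fderiv ℝ (wd n e l F) z = _ := h5.fderiv
    rw [h6]
    simp
    ring
  simp only [wd.eq_1 n c j (wd n d k F), wd.eq_1 n d k (wd n c j F), h3]
  rw [h2 (Pi.single j 1), h2 (Pi.single j 1), h2 (Pi.single j Complex.I),
    h2 (Pi.single j Complex.I)]
  ring

lemma tsupport_wd_subset : tsupport (wd n c j F) ⊆ tsupport F := by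
  refine closure_minimal (fun x hx => ?_) (isClosed_tsupport _)
  by_contra h
  have h1 : F =ᶠ[nhds x] fun _ => 0 := notMem_tsupport_iff_eventuallyEq.1 h
  exact hx ((wd_congr h1).trans (wd_const 0))

lemma wd_eq_zero_of_notMem (h : z ∉ tsupport F) : wd n c j F z = 0 :=
  image_eq_zero_of_notMem_tsupport fun h' => h (tsupport_wd_subset h')

lemma HasCompactSupport.wd (hF : HasCompactSupport F) : HasCompactSupport (wd n c j F) :=
  hF.mono' (subset_closure.trans tsupport_wd_subset)

lemma integral_fderiv_apply_eq_zero (hF : ContDiff ℝ 1 F) (hc : HasCompactSupport F)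
    (v : Fin n → ℂ) : ∫ x, fderiv ℝ F x v = 0 := by
  have h1 : Continuous fun x => fderiv ℝ F x v := by
    have := hF.continuous_fderiv one_ne_zero
    fun_prop
  have h2 : HasCompactSupport fun x => fderiv ℝ F x v := hc.fderiv_apply ℝ v
  have := integral_mul_fderiv_eq_neg_fderiv_mul_of_integrable (μ := volume)
    (f := fun _ : Fin n → ℂ => (1 : ℂ)) (g := F) (v := v) (by simp)
    (by simpa using h1.integrable_of_hasCompactSupport h2)
    (by simpa using hF.continuous.integrable_of_hasCompactSupport hc)
    (fun x _ => by fun_prop) (fun x _ => (hF.differentiable one_ne_zero) x)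
  simpa using this

lemma integral_wd_eq_zero (hF : ContDiff ℝ 1 F) (hc : HasCompactSupport F) :
    ∫ x, wd n c j F x = 0 := by
  have hi : ∀ v : Fin n → ℂ, Integrable fun x => fderiv ℝ F x v := fun v =>
    (show Continuous fun x => fderiv ℝ F x v by
      have := hF.continuous_fderiv one_ne_zero
      fun_prop).integrable_of_hasCompactSupport (hc.fderiv_apply ℝ v)
  simp only [wd]
  rw [integral_const_mul, integral_add (hi _) ((hi _).const_mul _), integral_const_mul,
    integral_fderiv_apply_eq_zero hF hc, integral_fderiv_apply_eq_zero hF hc]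
  simp

lemma integral_mul_wd (hF : ContDiff ℝ 1 F) (hG : ContDiff ℝ 1 G) (hc : HasCompactSupport G) :
    ∫ x, F x * wd n c j G x = - ∫ x, wd n c j F x * G x := by
  have hF' := (contDiff_wd (c := c) (j := j) (m := 0) hF (by simp)).continuous
  have hG' := (contDiff_wd (c := c) (j := j) (m := 0) hG (by simp)).continuous
  have h := integral_wd_eq_zero (c := c) (j := j) (hF.mul hG) hc.mul_left
  have h1 : ∀ x, wd n c j (fun x => F x * G x) x = wd n c j F x * G x + F x * wd n c j G x :=
    fun x => wd_mul (hF.differentiable one_ne_zero x) (hG.differentiable one_ne_zero x)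
  simp only [h1] at h
  have i1 : Integrable fun x => wd n c j F x * G x :=
    (hF'.mul hG.continuous).integrable_of_hasCompactSupport hc.mul_left
  have i2 : Integrable fun x => F x * wd n c j G x :=
    (hF.continuous.mul hG').integrable_of_hasCompactSupport hc.wd.mul_left
  rw [integral_add i1 i2] at h
  linear_combination h

end Wirtinger

section Hessian

variable {n : ℕ} {c : ℂ} {j k : Fin n} {f g : (Fin n → ℂ) → ℝ} {z ξ : Fin n → ℂ}

lemma wd_ofReal (hf : DifferentiableAt ℝ f z) : wd n c j (fun x => (f x : ℂ)) z
    = (1 / 2) * ((fderiv ℝ f z (Pi.single j 1) : ℂ)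
      + c * (fderiv ℝ f z (Pi.single j Complex.I) : ℂ)) := by
  have h : HasFDerivAt (fun x => (f x : ℂ)) (Complex.ofRealCLM.comp (fderiv ℝ f z)) z :=
    Complex.ofRealCLM.hasFDerivAt.comp z hf.hasFDerivAt
  simp [wd, h.fderiv]

lemma wd_I_ofReal (hf : DifferentiableAt ℝ f z) : wd n Complex.I j (fun x => (f x : ℂ)) z
    = (starRingEnd ℂ) (wd n (-Complex.I) j (fun x => (f x : ℂ)) z) := by
  simp [wd_ofReal hf, Complex.conj_ofNat]

lemma clm_apply_eq_sum {W : Type*} [NormedAddCommGroup W] [NormedSpace ℝ W]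
    (L : (Fin n → ℂ) →L[ℝ] W) (ξ : Fin n → ℂ) :
    L ξ = ∑ j, ((ξ j).re • L (Pi.single j 1) + (ξ j).im • L (Pi.single j Complex.I)) := by
  have h : ξ = ∑ j, ((ξ j).re • (Pi.single j 1 : Fin n → ℂ)
      + (ξ j).im • (Pi.single j Complex.I : Fin n → ℂ)) := by
    ext i
    simp [Finset.sum_apply, Pi.single_apply, Finset.sum_add_distrib, Complex.re_add_im]
  conv_lhs => rw [h]
  simp [map_sum]

lemma delPair_eq_sum (hf : DifferentiableAt ℝ f z) :
    delPair n f z ξ = ∑ j, wd n (-Complex.I) j (fun x => (f x : ℂ)) z * ξ j := by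
  have hL := fun v => clm_apply_eq_sum (fderiv ℝ f z) v
  simp only [delPair, wd_ofReal hf]
  rw [hL ξ, hL (Complex.I • ξ)]
  push_cast
  rw [Finset.mul_sum, ← Finset.sum_sub_distrib, Finset.mul_sum]
  refine Finset.sum_congr rfl fun j _ => ?_
  conv_rhs => rw [← Complex.re_add_im (ξ j)]
  simp only [Pi.smul_apply, smul_eq_mul, Complex.mul_re, Complex.mul_im, Complex.I_re,
    Complex.I_im]
  push_cast
  linear_combination (1 / 2 * (ξ j).im * (fderiv ℝ f z (Pi.single j Complex.I) : ℂ))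
    * Complex.I_sq

lemma hessC_eq_sum (hf : ContDiff ℝ 2 f) :
    hessC n f z ξ = (∑ j, ∑ k, wd n (-Complex.I) j (wd n Complex.I k (fun x => (f x : ℂ))) z
      * (ξ j * (starRingEnd ℂ) (ξ k))).re := by
  have h1 : Differentiable ℝ (fderiv ℝ f) :=
    (hf.fderiv_right (m := 1) (by norm_num)).differentiable one_ne_zero
  have hwd : ∀ k, wd n Complex.I k (fun x => (f x : ℂ)) = fun x => (1 / 2) *
      ((fderiv ℝ f x (Pi.single k 1) : ℂ)
      + Complex.I * (fderiv ℝ f x (Pi.single k Complex.I) : ℂ)) :=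
    fun k => funext fun x => wd_ofReal (hf.differentiable two_ne_zero x)
  set B := fderiv ℝ (fderiv ℝ f) z with hB
  have h4 : ∀ w : Fin n → ℂ, HasFDerivAt (fun x => fderiv ℝ f x w) (B.flip w) z := fun w => by
    simpa using! (h1 z).hasFDerivAt.clm_apply (hasFDerivAt_const w z)
  have hd : ∀ w : Fin n → ℂ, DifferentiableAt ℝ (fun x => fderiv ℝ f x w) z :=
    fun w => (h4 w).differentiableAt
  have hdc : ∀ w : Fin n → ℂ, DifferentiableAt ℝ (fun x => ((fderiv ℝ f x w : ℝ) : ℂ)) z :=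
    fun w => Complex.ofRealCLM.differentiableAt.comp z (hd w)
  have hwd2 : ∀ j k, wd n (-Complex.I) j (wd n Complex.I k (fun x => (f x : ℂ))) z
      = (1 / 4) * ((B (Pi.single j 1) (Pi.single k 1) : ℂ)
        - Complex.I * (B (Pi.single j Complex.I) (Pi.single k 1) : ℂ)
        + Complex.I * (B (Pi.single j 1) (Pi.single k Complex.I) : ℂ)
        + (B (Pi.single j Complex.I) (Pi.single k Complex.I) : ℂ)) := by
    intro j k
    have h5 : DifferentiableAt ℝ (fun x => (fderiv ℝ f x (Pi.single k 1) : ℂ)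
        + Complex.I * (fderiv ℝ f x (Pi.single k Complex.I) : ℂ)) z :=
      (hdc _).add ((hdc _).const_mul _)
    rw [hwd, wd_const_mul _ h5,
      wd_add (hdc _) ((hdc _).const_mul _), wd_const_mul _ (hdc _), wd_ofReal (hd _),
      wd_ofReal (hd _), (h4 _).fderiv, (h4 _).fderiv]
    simp only [ContinuousLinearMap.flip_apply]
    linear_combination (-(B (Pi.single j Complex.I) (Pi.single k Complex.I) : ℂ) / 4)
      * Complex.I_sq
  have hBB : ∀ v : Fin n → ℂ, iteratedFDeriv ℝ 2 f z ![v, v] = B v v := fun v => by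
    simp [iteratedFDeriv_two_apply, hB]
  have hBe : ∀ v : Fin n → ℂ, B v v = ∑ j, ∑ k,
      ((v j).re * (v k).re * B (Pi.single j 1) (Pi.single k 1)
      + (v j).re * (v k).im * B (Pi.single j 1) (Pi.single k Complex.I)
      + (v j).im * (v k).re * B (Pi.single j Complex.I) (Pi.single k 1)
      + (v j).im * (v k).im * B (Pi.single j Complex.I) (Pi.single k Complex.I)) := by
    intro v
    conv_lhs => rw [clm_apply_eq_sum B v]
    simp only [_root_.sum_apply, _root_.add_apply, _root_.smul_apply, smul_eq_mul]
    refine Finset.sum_congr rfl fun j _ => ?_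
    rw [clm_apply_eq_sum (B (Pi.single j 1)) v, clm_apply_eq_sum (B (Pi.single j Complex.I)) v,
      Finset.mul_sum, Finset.mul_sum, ← Finset.sum_add_distrib]
    refine Finset.sum_congr rfl fun k _ => ?_
    simp only [smul_eq_mul]
    ring
  rw [hessC, hBB, hBB, hBe, hBe, ← Finset.sum_add_distrib, Finset.mul_sum, Complex.re_sum]
  refine Finset.sum_congr rfl fun j _ => ?_
  rw [← Finset.sum_add_distrib, Finset.mul_sum, Complex.re_sum]
  refine Finset.sum_congr rfl fun k _ => ?_
  rw [hwd2]
  simp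
  ring

lemma delPair_exp (hf : DifferentiableAt ℝ f z) :
    delPair n (fun x => Real.exp (f x)) z ξ = Real.exp (f z) * delPair n f z ξ := by
  simp only [delPair, hf.hasFDerivAt.exp.fderiv, _root_.smul_apply, smul_eq_mul]
  push_cast
  ring

lemma delPair_const_mul (a : ℝ) (hf : DifferentiableAt ℝ f z) :
    delPair n (fun x => a * f x) z ξ = a * delPair n f z ξ := by
  simp only [delPair, fderiv_const_mul hf, _root_.smul_apply, smul_eq_mul]
  push_cast
  ring

lemma differentiable_wd (hf : ContDiff ℝ 2 f) :
    Differentiable ℝ (wd n c j (fun x => (f x : ℂ))) :=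
  (contDiff_wd (m := 1) (Complex.ofRealCLM.contDiff.comp hf) (by norm_num)).differentiable
    one_ne_zero

lemma hessC_add (hf : ContDiff ℝ 2 f) (hg : ContDiff ℝ 2 g) :
    hessC n (fun x => f x + g x) z ξ = hessC n f z ξ + hessC n g z ξ := by
  have hcf : ContDiff ℝ 2 fun x => (f x : ℂ) := Complex.ofRealCLM.contDiff.comp hf
  have hcg : ContDiff ℝ 2 fun x => (g x : ℂ) := Complex.ofRealCLM.contDiff.comp hg
  have h : ∀ k, wd n Complex.I k (fun x => ((f x + g x : ℝ) : ℂ)) = fun x =>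
      wd n Complex.I k (fun x => (f x : ℂ)) x + wd n Complex.I k (fun x => (g x : ℂ)) x :=
    fun k => funext fun x => by
      simpa using wd_add (hcf.differentiable two_ne_zero x) (hcg.differentiable two_ne_zero x)
  rw [hessC_eq_sum (hf.add hg), hessC_eq_sum hf, hessC_eq_sum hg, ← Complex.add_re,
    ← Finset.sum_add_distrib]
  congr 1
  refine Finset.sum_congr rfl fun j _ => ?_
  rw [← Finset.sum_add_distrib]
  refine Finset.sum_congr rfl fun k _ => ?_
  rw [h, wd_add (differentiable_wd hf z) (differentiable_wd hg z), add_mul]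

lemma hessC_const_mul (a : ℝ) (hf : ContDiff ℝ 2 f) :
    hessC n (fun x => a * f x) z ξ = a * hessC n f z ξ := by
  have hcf : ContDiff ℝ 2 fun x => (f x : ℂ) := Complex.ofRealCLM.contDiff.comp hf
  have h : ∀ k, wd n Complex.I k (fun x => ((a * f x : ℝ) : ℂ)) = fun x =>
      a * wd n Complex.I k (fun x => (f x : ℂ)) x :=
    fun k => funext fun x => by
      simpa using wd_const_mul (a : ℂ) (hcf.differentiable two_ne_zero x)
  rw [hessC_eq_sum (contDiff_const.mul hf), hessC_eq_sum hf, ← Complex.re_ofReal_mul]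
  congr 1
  simp only [Finset.mul_sum]
  refine Finset.sum_congr rfl fun j _ => Finset.sum_congr rfl fun k _ => ?_
  rw [h, wd_const_mul _ (differentiable_wd hf z), mul_assoc]

lemma hessC_exp (hf : ContDiff ℝ 2 f) :
    hessC n (fun x => Real.exp (f x)) z ξ
      = Real.exp (f z) * (hessC n f z ξ + Complex.normSq (delPair n f z ξ)) := by
  have hcf : ContDiff ℝ 2 fun x => (f x : ℂ) := Complex.ofRealCLM.contDiff.comp hf
  have hd := hcf.differentiable two_ne_zero
  have hde : Differentiable ℝ fun x => Complex.exp (f x) := hd.cexp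
  have h : ∀ k, wd n Complex.I k (fun x => ((Real.exp (f x) : ℝ) : ℂ)) = fun x =>
      Complex.exp (f x) * wd n Complex.I k (fun x => (f x : ℂ)) x :=
    fun k => funext fun x => by
      simpa using wd_exp (hd x)
  have h2 : Complex.normSq (delPair n f z ξ) = (∑ j, ∑ k,
      (wd n (-Complex.I) j (fun x => (f x : ℂ)) z * wd n Complex.I k (fun x => (f x : ℂ)) z)
      * (ξ j * (starRingEnd ℂ) (ξ k))).re := by
    rw [← Complex.ofReal_re (Complex.normSq _), ← Complex.mul_conj,
      delPair_eq_sum (hf.differentiable two_ne_zero z), map_sum, Finset.sum_mul_sum]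
    congr 1
    refine Finset.sum_congr rfl fun j _ => Finset.sum_congr rfl fun k _ => ?_
    rw [wd_I_ofReal (hf.differentiable two_ne_zero z), map_mul]
    ring
  rw [hessC_eq_sum hf.exp, hessC_eq_sum hf, h2, ← Complex.add_re,
    ← Complex.re_ofReal_mul]
  congr 1
  rw [← Finset.sum_add_distrib, Finset.mul_sum]
  refine Finset.sum_congr rfl fun j _ => ?_
  rw [← Finset.sum_add_distrib, Finset.mul_sum]
  refine Finset.sum_congr rfl fun k _ => ?_
  rw [h, wd_mul (hde z) (differentiable_wd hf z), wd_exp (hd z)]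
  push_cast
  ring

lemma delPair_congr (h : f =ᶠ[nhds z] g) : delPair n f z ξ = delPair n g z ξ := by
  simp only [delPair, h.fderiv_eq]

lemma hessC_congr (h : f =ᶠ[nhds z] g) : hessC n f z ξ = hessC n g z ξ := by
  simp only [hessC, Filter.EventuallyEq.eq_of_nhds (h.iteratedFDeriv ℝ 2)]

end Hessian

section BasicEstimate

variable {n : ℕ} {φ : (Fin n → ℂ) → ℝ} {γ : Fin n → (Fin n → ℂ) → ℂ}

/-- `e^φ ∂/∂z̄_j (e^{-φ} g)`. -/
def twistedWd (n : ℕ) (φ : (Fin n → ℂ) → ℝ) (j : Fin n) (g : (Fin n → ℂ) → ℂ)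
    (x : Fin n → ℂ) : ℂ :=
  wd n Complex.I j g x - wd n Complex.I j (fun y => (φ y : ℂ)) x * g x

lemma contDiff_twistedWd (hφ : ContDiff ℝ 2 φ) {g : (Fin n → ℂ) → ℂ} (hg : ContDiff ℝ 2 g)
    (j : Fin n) : ContDiff ℝ 1 (twistedWd n φ j g) := by
  have h1 : ContDiff ℝ 1 (wd n Complex.I j g) := contDiff_wd hg (by norm_num)
  have h2 : ContDiff ℝ 1 (wd n Complex.I j (fun y => (φ y : ℂ))) :=
    contDiff_wd (Complex.ofRealCLM.contDiff.comp hφ) (by norm_num)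
  have h3 : ContDiff ℝ 1 g := hg.of_le (by norm_num)
  exact h1.sub (h2.mul h3)

lemma contDiff_cexp_neg (hφ : ContDiff ℝ 2 φ) :
    ContDiff ℝ 2 fun x => Complex.exp (-(φ x : ℂ)) :=
  (Complex.ofRealCLM.contDiff.comp hφ).neg.cexp

lemma twisted_product_eq (hφ : ContDiff ℝ 2 φ) {g h : (Fin n → ℂ) → ℂ} (hg : ContDiff ℝ 2 g)
    (hh : ContDiff ℝ 2 h) (j k : Fin n) (x : Fin n → ℂ) :
    twistedWd n φ j g x * (starRingEnd ℂ) (twistedWd n φ k h x) * Complex.exp (-(φ x : ℂ))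
    = wd n (-Complex.I) k (wd n Complex.I j (fun y => (φ y : ℂ))) x
        * ((starRingEnd ℂ) (h x) * g x) * Complex.exp (-(φ x : ℂ))
      + wd n (-Complex.I) k g x * (starRingEnd ℂ) (wd n (-Complex.I) j h x)
        * Complex.exp (-(φ x : ℂ))
      + wd n (-Complex.I) k (fun y => twistedWd n φ j g y
          * (Complex.exp (-(φ y : ℂ)) * (starRingEnd ℂ) (h y))) x
      - wd n Complex.I j (fun y => wd n (-Complex.I) k g y
          * (Complex.exp (-(φ y : ℂ)) * (starRingEnd ℂ) (h y))) x := by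
  have hφc : ContDiff ℝ 2 fun x => (φ x : ℂ) := Complex.ofRealCLM.contDiff.comp hφ
  have d1 : DifferentiableAt ℝ (fun x => (φ x : ℂ)) x := hφc.differentiable two_ne_zero x
  have d2 : DifferentiableAt ℝ (fun x => Complex.exp (-(φ x : ℂ))) x :=
    (contDiff_cexp_neg hφ).differentiable two_ne_zero x
  have d3 : DifferentiableAt ℝ h x := hh.differentiable two_ne_zero x
  have d4 : DifferentiableAt ℝ (fun x => (starRingEnd ℂ) (h x)) x :=
    (Complex.conjCLE : ℂ →L[ℝ] ℂ).differentiableAt.comp x d3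
  have d5 : DifferentiableAt ℝ (twistedWd n φ j g) x :=
    (contDiff_twistedWd hφ hg j).differentiable one_ne_zero x
  have d6 : DifferentiableAt ℝ (wd n (-Complex.I) k g) x :=
    (contDiff_wd (m := 1) hg (by norm_num)).differentiable one_ne_zero x
  have d7 : DifferentiableAt ℝ (wd n Complex.I j g) x :=
    (contDiff_wd (m := 1) hg (by norm_num)).differentiable one_ne_zero x
  have d8 : DifferentiableAt ℝ (wd n Complex.I j (fun y => (φ y : ℂ))) x :=
    differentiable_wd hφ x
  have d9 : DifferentiableAt ℝ g x := hg.differentiable two_ne_zero x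
  have d10 : DifferentiableAt ℝ (fun x => -(φ x : ℂ)) x := d1.neg
  have d11 : DifferentiableAt ℝ (fun x => wd n Complex.I j (fun y => (φ y : ℂ)) x * g x) x :=
    d8.mul d9
  have d12 : DifferentiableAt ℝ
      (fun x => Complex.exp (-(φ x : ℂ)) * (starRingEnd ℂ) (h x)) x := d2.mul d4
  have e1 : ∀ c l, wd n c l (fun x => Complex.exp (-(φ x : ℂ))) x
      = -(Complex.exp (-(φ x : ℂ)) * wd n c l (fun x => (φ x : ℂ)) x) := fun c l => by
    rw [wd_exp d10, wd_neg]; ring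
  have e2 : wd n (-Complex.I) k (twistedWd n φ j g) x
      = wd n (-Complex.I) k (wd n Complex.I j g) x
        - (wd n (-Complex.I) k (wd n Complex.I j (fun y => (φ y : ℂ))) x * g x
          + wd n Complex.I j (fun y => (φ y : ℂ)) x * wd n (-Complex.I) k g x) := by
    rw [← wd_mul d8 d9, ← wd_sub d7 d11]
    rfl
  rw [wd_mul d5 d12, wd_mul d2 d4, wd_mul d6 d12, wd_mul d2 d4, e1, e1, e2,
    wd_star d3, wd_star d3, wd_comm (c := Complex.I) hg]
  simp only [twistedWd, map_sub, map_mul, map_neg, Complex.conj_I, neg_neg,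
    wd_I_ofReal (j := k) (hφ.differentiable two_ne_zero x), Complex.conj_conj]
  ring

lemma sum_normSq_sub_swap {ι : Type*} [Fintype ι] (a : ι → ι → ℂ) :
    (1 / 2) * ∑ j, ∑ k, Complex.normSq (a j k - a k j)
      = ∑ j, ∑ k, Complex.normSq (a j k)
        - (∑ j, ∑ k, a k j * (starRingEnd ℂ) (a j k)).re := by
  have h1 : ∑ j, ∑ k, Complex.normSq (a k j) = ∑ j, ∑ k, Complex.normSq (a j k) :=
    Finset.sum_comm
  simp only [Complex.normSq_sub, Finset.sum_add_distrib, Finset.sum_sub_distrib, h1,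
    Complex.re_sum, ← Finset.mul_sum]
  have h2 : ∀ j k, (a j k * (starRingEnd ℂ) (a k j)).re
      = (a k j * (starRingEnd ℂ) (a j k)).re := fun j k => by
    simp; ring
  simp only [h2]
  ring

/-- The Morrey–Kohn–Hörmander inequality for compactly supported forms. -/
lemma integral_hessC_le (hφ : ContDiff ℝ 2 φ) (hγ : ∀ j, ContDiff ℝ 2 (γ j))
    (hc : ∀ j, HasCompactSupport (γ j)) :
    (Integrable fun x => hessC n φ x (fun j => (starRingEnd ℂ) (γ j x)) * Real.exp (-φ x)) ∧
    (Integrable fun x => ((1 / 2) * ∑ j, ∑ k, Complex.normSq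
          (wd n (-Complex.I) j (γ k) x - wd n (-Complex.I) k (γ j) x)
        + Complex.normSq (∑ j, twistedWd n φ j (γ j) x)) * Real.exp (-φ x)) ∧
    ∫ x, hessC n φ x (fun j => (starRingEnd ℂ) (γ j x)) * Real.exp (-φ x)
    ≤ ∫ x, ((1 / 2) * ∑ j, ∑ k, Complex.normSq
          (wd n (-Complex.I) j (γ k) x - wd n (-Complex.I) k (γ j) x)
        + Complex.normSq (∑ j, twistedWd n φ j (γ j) x)) * Real.exp (-φ x) := by
  have hstar : ∀ k, ContDiff ℝ 2 fun x => (starRingEnd ℂ) (γ k x) := fun k =>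
    (Complex.conjCLE : ℂ →L[ℝ] ℂ).contDiff.comp (hγ k)
  have hE := contDiff_cexp_neg hφ
  have hEst : ∀ k, ContDiff ℝ 1 fun x => Complex.exp (-(φ x : ℂ)) * (starRingEnd ℂ) (γ k x) :=
    fun k => (hE.mul (hstar k)).of_le (by norm_num)
  have hcst : ∀ k, HasCompactSupport fun x =>
      Complex.exp (-(φ x : ℂ)) * (starRingEnd ℂ) (γ k x) := fun k =>
    ((hc k).comp_left (g := starRingEnd ℂ) (map_zero _)).mul_left
  have hw : ∀ c j k, ContDiff ℝ 1 (wd n c j (γ k)) := fun c j k =>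
    contDiff_wd (hγ k) (by norm_num)
  have ht : ∀ j, ContDiff ℝ 1 (twistedWd n φ j (γ j)) := fun j => contDiff_twistedWd hφ (hγ j) j
  set P : Fin n → Fin n → (Fin n → ℂ) → ℂ := fun j k y => twistedWd n φ j (γ j) y
          * (Complex.exp (-(φ y : ℂ)) * (starRingEnd ℂ) (γ k y)) with hP
  set Q : Fin n → Fin n → (Fin n → ℂ) → ℂ := fun j k y => wd n (-Complex.I) k (γ j) y
          * (Complex.exp (-(φ y : ℂ)) * (starRingEnd ℂ) (γ k y)) with hQ
  have hPc : ∀ j k, ContDiff ℝ 1 (P j k) := fun j k => (ht j).mul (hEst k)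
  have hQc : ∀ j k, ContDiff ℝ 1 (Q j k) := fun j k => (hw _ k j).mul (hEst k)
  have hPs : ∀ j k, HasCompactSupport (P j k) := fun j k => (hcst k).mul_left
  have hQs : ∀ j k, HasCompactSupport (Q j k) := fun j k => (hcst k).mul_left
  have hPi : ∀ j k, Integrable (wd n (-Complex.I) k (P j k)) := fun j k =>
    (contDiff_wd (m := 0) (hPc j k) (by simp)).continuous.integrable_of_hasCompactSupport
      (hPs j k).wd
  have hQi : ∀ j k, Integrable (wd n Complex.I j (Q j k)) := fun j k =>
    (contDiff_wd (m := 0) (hQc j k) (by simp)).continuous.integrable_of_hasCompactSupport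
      (hQs j k).wd
  have key : ∀ x, ((1 / 2) * ∑ j, ∑ k, Complex.normSq
          (wd n (-Complex.I) j (γ k) x - wd n (-Complex.I) k (γ j) x)
        + Complex.normSq (∑ j, twistedWd n φ j (γ j) x)) * Real.exp (-φ x)
      = hessC n φ x (fun j => (starRingEnd ℂ) (γ j x)) * Real.exp (-φ x)
        + (∑ j, ∑ k, Complex.normSq (wd n (-Complex.I) j (γ k) x)) * Real.exp (-φ x)
        + (∑ j, ∑ k, (wd n (-Complex.I) k (P j k) x - wd n Complex.I j (Q j k) x)).re := by
    intro x
    have h1 : Complex.normSq (∑ j, twistedWd n φ j (γ j) x) * Real.exp (-φ x)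
        = (∑ j, ∑ k, twistedWd n φ j (γ j) x * (starRingEnd ℂ) (twistedWd n φ k (γ k) x)
          * Complex.exp (-(φ x : ℂ))).re := by
      simp only [← Finset.sum_mul]
      rw [← Finset.sum_mul_sum, ← map_sum, Complex.mul_conj, ← Complex.ofReal_neg,
        ← Complex.ofReal_exp, ← Complex.ofReal_mul, Complex.ofReal_re]
    have h2 : hessC n φ x (fun j => (starRingEnd ℂ) (γ j x)) * Real.exp (-φ x)
        = (∑ j, ∑ k, wd n (-Complex.I) k (wd n Complex.I j (fun y => (φ y : ℂ))) x
        * ((starRingEnd ℂ) (γ k x) * γ j x) * Complex.exp (-(φ x : ℂ))).re := by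
      rw [hessC_eq_sum hφ, Finset.sum_comm, ← Complex.ofReal_neg, ← Complex.ofReal_exp]
      simp only [← Finset.sum_mul, Complex.conj_conj, Complex.re_mul_ofReal]
    have h3 : (∑ j, ∑ k, wd n (-Complex.I) k (γ j) x
          * (starRingEnd ℂ) (wd n (-Complex.I) j (γ k) x)).re * Real.exp (-φ x)
        = (∑ j, ∑ k, wd n (-Complex.I) k (γ j) x
          * (starRingEnd ℂ) (wd n (-Complex.I) j (γ k) x) * Complex.exp (-(φ x : ℂ))).re := by
      rw [← Complex.ofReal_neg, ← Complex.ofReal_exp]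
      simp only [← Finset.sum_mul, Complex.re_mul_ofReal]
    have h4 := sum_normSq_sub_swap (fun j k => wd n (-Complex.I) j (γ k) x)
    rw [add_mul, h4, sub_mul, h1, h2, h3]
    simp only [twisted_product_eq hφ (hγ _) (hγ _), hP, hQ, Finset.sum_add_distrib,
      Finset.sum_sub_distrib, Complex.add_re, Complex.sub_re]
    ring
  have hdiv : ∫ x, (∑ j, ∑ k, (wd n (-Complex.I) k (P j k) x - wd n Complex.I j (Q j k) x)).re
      = 0 := by
    have hi : ∀ j k, Integrable fun x =>
        wd n (-Complex.I) k (P j k) x - wd n Complex.I j (Q j k) x :=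
      fun j k => (hPi j k).sub (hQi j k)
    have hi2 : ∀ j, Integrable fun x => ∑ k,
        (wd n (-Complex.I) k (P j k) x - wd n Complex.I j (Q j k) x) :=
      fun j => integrable_finsetSum _ fun k _ => hi j k
    have h0 : ∫ x, (∑ j, ∑ k, (wd n (-Complex.I) k (P j k) x - wd n Complex.I j (Q j k) x))
        = 0 := by
      rw [integral_finsetSum _ fun j _ => hi2 j]
      refine Finset.sum_eq_zero fun j _ => ?_
      rw [integral_finsetSum _ fun k _ => hi j k]
      refine Finset.sum_eq_zero fun k _ => ?_
      rw [integral_sub (hPi j k) (hQi j k), integral_wd_eq_zero (hPc j k) (hPs j k),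
        integral_wd_eq_zero (hQc j k) (hQs j k), sub_zero]
    have := integral_re (𝕜 := ℂ) (integrable_finsetSum Finset.univ fun j _ => hi2 j)
    exact this.trans (by rw [h0]; rfl)
  have hEc : Continuous fun x => Real.exp (-φ x) := (hφ.continuous.neg).rexp
  have hR1 : Continuous fun x => (∑ j, ∑ k, Complex.normSq (wd n (-Complex.I) j (γ k) x)) := by
    have := fun j k => (hw (-Complex.I) j k).continuous
    exact continuous_finsetSum _ fun j _ => continuous_finsetSum _ fun k _ =>
      Complex.continuous_normSq.comp (this j k)
  have hS : IsCompact (⋃ j, tsupport (γ j)) := isCompact_iUnion fun j => hc j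
  have hz : ∀ x ∉ ⋃ j, tsupport (γ j), (∀ j, γ j x = 0) ∧ ∀ c j k, wd n c j (γ k) x = 0 := by
    intro x hx
    simp only [mem_iUnion, not_exists] at hx
    exact ⟨fun j => image_eq_zero_of_notMem_tsupport (hx j),
      fun c j k => wd_eq_zero_of_notMem (hx k)⟩
  have hI1 : Integrable fun x => (∑ j, ∑ k, Complex.normSq (wd n (-Complex.I) j (γ k) x))
      * Real.exp (-φ x) := by
    refine (hR1.mul hEc).integrable_of_hasCompactSupport
      (HasCompactSupport.intro hS fun x hx => ?_)
    simp [(hz x hx).2]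
  have hI2 : Integrable fun x => ((1 / 2) * ∑ j, ∑ k, Complex.normSq
          (wd n (-Complex.I) j (γ k) x - wd n (-Complex.I) k (γ j) x)
        + Complex.normSq (∑ j, twistedWd n φ j (γ j) x)) * Real.exp (-φ x) := by
    refine Continuous.integrable_of_hasCompactSupport (Continuous.mul ?_ hEc)
      (HasCompactSupport.intro hS fun x hx => ?_)
    · have h1 := fun j k => (hw (-Complex.I) j k).continuous
      have h2 := fun j => (ht j).continuous
      exact (continuous_const.mul (continuous_finsetSum _ fun j _ => continuous_finsetSum _
        fun k _ => Complex.continuous_normSq.comp ((h1 j k).sub (h1 k j)))).add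
        (Complex.continuous_normSq.comp (continuous_finsetSum _ fun j _ => h2 j))
    · simp [(hz x hx).1, (hz x hx).2, twistedWd]
  have hI3 : Integrable fun x => (∑ j, ∑ k,
      (wd n (-Complex.I) k (P j k) x - wd n Complex.I j (Q j k) x)).re :=
    (integrable_finsetSum _ fun j _ => integrable_finsetSum _ fun k _ =>
      (hPi j k).sub (hQi j k)).re
  have hI4 : Integrable fun x =>
      hessC n φ x (fun j => (starRingEnd ℂ) (γ j x)) * Real.exp (-φ x) := by
    refine ((hI2.sub hI1).sub hI3).congr (Filter.Eventually.of_forall fun x => ?_)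
    simp only [Pi.sub_apply, key x]
    ring
  have hI5 : Integrable fun x =>
      hessC n φ x (fun j => (starRingEnd ℂ) (γ j x)) * Real.exp (-φ x)
      + (∑ j, ∑ k, Complex.normSq (wd n (-Complex.I) j (γ k) x)) * Real.exp (-φ x) := hI4.add hI1
  refine ⟨hI4, hI2, ?_⟩
  simp only [key]
  rw [integral_add hI5 hI3, hdiv, integral_add hI4 hI1, add_zero]
  refine le_add_of_nonneg_right (integral_nonneg fun x => mul_nonneg ?_ (Real.exp_pos _).le)
  exact Finset.sum_nonneg fun j _ => Finset.sum_nonneg fun k _ => Complex.normSq_nonneg _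

end BasicEstimate

section Weights

variable {n : ℕ} {ψ f : (Fin n → ℂ) → ℝ} {z ξ : Fin n → ℂ}

/-- The weight `2 ψ + e^{2 f}`. -/
def wtMain (n : ℕ) (ψ f : (Fin n → ℂ) → ℝ) (x : Fin n → ℂ) : ℝ :=
  2 * ψ x + Real.exp (2 * f x)

/-- The twisting exponent `ψ + e^{2 f} - e^f`. -/
def wtTwist (n : ℕ) (ψ f : (Fin n → ℂ) → ℝ) (x : Fin n → ℂ) : ℝ :=
  ψ x + (Real.exp (2 * f x) + (-1) * Real.exp (f x))

/-- The multiplier `exp (e^{2 f} - 2 e^f)`. -/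
def wtMult (n : ℕ) (f : (Fin n → ℂ) → ℝ) (x : Fin n → ℂ) : ℝ :=
  Real.exp (Real.exp (2 * f x) - 2 * Real.exp (f x))

lemma contDiff_wtMain (hψ : ContDiff ℝ 2 ψ) (hf : ContDiff ℝ 2 f) :
    ContDiff ℝ 2 (wtMain n ψ f) :=
  (contDiff_const.mul hψ).add (contDiff_const.mul hf).exp

lemma contDiff_wtTwist (hψ : ContDiff ℝ 2 ψ) (hf : ContDiff ℝ 2 f) :
    ContDiff ℝ 2 (wtTwist n ψ f) :=
  hψ.add ((contDiff_const.mul hf).exp.add (contDiff_const.mul hf.exp))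

lemma contDiff_wtMult (hf : ContDiff ℝ 2 f) : ContDiff ℝ 2 (wtMult n f) :=
  ((contDiff_const.mul hf).exp.sub (contDiff_const.mul hf.exp)).exp

lemma wtMult_eq (x : Fin n → ℂ) :
    Real.exp (wtTwist n ψ f x) ^ 2 * Real.exp (-wtMain n ψ f x) = wtMult n f x := by
  rw [← Real.exp_nat_mul, ← Real.exp_add, wtTwist, wtMain, wtMult]
  congr 1
  push_cast
  ring

lemma wtMult_pos (x : Fin n → ℂ) : 0 < wtMult n f x := Real.exp_pos _

lemma exp_neg_one_le_wtMult (x : Fin n → ℂ) : Real.exp (-1) ≤ wtMult n f x := by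
  refine Real.exp_le_exp.2 ?_
  have : Real.exp (2 * f x) = Real.exp (f x) ^ 2 := by rw [← Real.exp_nat_mul]; norm_cast
  nlinarith [sq_nonneg (Real.exp (f x) - 1)]

lemma hessC_mul_real (hf : ContDiff ℝ 2 f) (r : ℝ) :
    hessC n f z (fun j => r * ξ j) = r ^ 2 * hessC n f z ξ := by
  rw [hessC_eq_sum hf, hessC_eq_sum hf, ← Complex.re_ofReal_mul]
  simp only [Finset.mul_sum, map_mul, Complex.conj_ofReal]
  congr 1
  refine Finset.sum_congr rfl fun j _ => Finset.sum_congr rfl fun k _ => ?_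
  push_cast
  ring

lemma normSq_delPair_exp_le (hf : ContDiff ℝ 2 f) (h : 0 ≤ hessC n f z ξ) :
    4 * Complex.normSq (delPair n (fun x => Real.exp (f x)) z ξ)
      ≤ hessC n (fun x => Real.exp (2 * f x)) z ξ := by
  have hd := hf.differentiable two_ne_zero z
  rw [delPair_exp hd, hessC_exp (contDiff_const.mul hf), hessC_const_mul 2 hf,
    delPair_const_mul 2 hd, Complex.normSq_mul, Complex.normSq_mul, Complex.normSq_ofReal,
    Complex.normSq_ofReal]
  have : Real.exp (2 * f z) = Real.exp (f z) * Real.exp (f z) := by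
    rw [← Real.exp_add]; ring_nf
  rw [this]
  have h2 := mul_nonneg (mul_self_nonneg (Real.exp (f z))) h
  nlinarith

lemma normSq_sub_sub_le (a b c : ℂ) : Complex.normSq (a - b - c)
    ≤ 3 * (Complex.normSq a + Complex.normSq b + Complex.normSq c) := by
  simp only [Complex.normSq_apply, Complex.sub_re, Complex.sub_im]
  nlinarith [sq_nonneg (a.re + b.re), sq_nonneg (a.re + c.re), sq_nonneg (b.re - c.re),
    sq_nonneg (a.im + b.im), sq_nonneg (a.im + c.im), sq_nonneg (b.im - c.im)]

lemma sum_twistedWd_eq (hψ : ContDiff ℝ 2 ψ) (hf : ContDiff ℝ 2 f)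
    {G : Fin n → (Fin n → ℂ) → ℂ} (hG : ∀ j, DifferentiableAt ℝ (G j) z) :
    ∑ j, twistedWd n (wtMain n ψ f) j (fun y => (Real.exp (wtTwist n ψ f y) : ℂ) * G j y) z
    = (Real.exp (wtTwist n ψ f z) : ℂ) * (∑ j, wd n Complex.I j (G j) z
      - (starRingEnd ℂ) (delPair n ψ z fun j => (starRingEnd ℂ) (G j z))
      - (starRingEnd ℂ) (delPair n (fun x => Real.exp (f x)) z
          fun j => (starRingEnd ℂ) (G j z))) := by
  have dψ := hψ.differentiable two_ne_zero z
  have dm : DifferentiableAt ℝ (fun x => Real.exp (f x)) z := hf.exp.differentiable two_ne_zero z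
  have dψc : DifferentiableAt ℝ (fun x => (ψ x : ℂ)) z :=
    Complex.ofRealCLM.differentiableAt.comp z dψ
  have dmc : DifferentiableAt ℝ (fun x => (Real.exp (f x) : ℂ)) z :=
    Complex.ofRealCLM.differentiableAt.comp z dm
  have ds : DifferentiableAt ℝ (fun x => (wtTwist n ψ f x : ℂ)) z :=
    Complex.ofRealCLM.differentiableAt.comp z
      ((contDiff_wtTwist hψ hf).differentiable two_ne_zero z)
  have h1 : ∀ j, wd n Complex.I j (fun x => (wtMain n ψ f x : ℂ)) z
      = wd n Complex.I j (fun x => (wtTwist n ψ f x : ℂ)) z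
        + (wd n Complex.I j (fun x => (ψ x : ℂ)) z
          + wd n Complex.I j (fun x => (Real.exp (f x) : ℂ)) z) := by
    intro j
    have dψm : DifferentiableAt ℝ (fun x => (ψ x : ℂ) + (Real.exp (f x) : ℂ)) z := dψc.add dmc
    rw [← wd_add dψc dmc, ← wd_add ds dψm]
    congr 1
    funext x
    simp only [wtMain, wtTwist]
    push_cast
    ring
  have h2 : ∀ j, twistedWd n (wtMain n ψ f) j
      (fun y => (Real.exp (wtTwist n ψ f y) : ℂ) * G j y) z
      = (Real.exp (wtTwist n ψ f z) : ℂ) * (wd n Complex.I j (G j) z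
        - wd n Complex.I j (fun x => (ψ x : ℂ)) z * G j z
        - wd n Complex.I j (fun x => (Real.exp (f x) : ℂ)) z * G j z) := by
    intro j
    have de : DifferentiableAt ℝ (fun y => (Real.exp (wtTwist n ψ f y) : ℂ)) z :=
      Complex.ofRealCLM.differentiableAt.comp z
        ((contDiff_wtTwist hψ hf).exp.differentiable two_ne_zero z)
    rw [twistedWd, wd_mul de (hG j), h1]
    simp only [Complex.ofReal_exp]
    rw [wd_exp ds]
    simp only [← Complex.ofReal_exp]
    ring
  rw [Finset.sum_congr rfl fun j _ => h2 j, ← Finset.mul_sum, Finset.sum_sub_distrib,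
    Finset.sum_sub_distrib, delPair_eq_sum dψ, delPair_eq_sum dm, map_sum, map_sum]
  simp only [map_mul, Complex.conj_conj, wd_I_ofReal dψ, wd_I_ofReal dm]

/-- The weighted a priori estimate from which the closed range property is deduced. -/
lemma weighted_estimate (hψ : ContDiff ℝ 2 ψ) (hf : ContDiff ℝ 2 f) {E : ℝ}
    {U : Set (Fin n → ℂ)}
    (h1 : ∀ x ∈ U, ∀ ξ, 3 * Complex.normSq (delPair n ψ x ξ) ≤ hessC n ψ x ξ)
    (h2 : ∀ x ∈ U, ∀ ξ, E * enormSq n ξ ≤ hessC n ψ x ξ)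
    (h3 : ∀ x ∈ U, ∀ ξ, 0 ≤ hessC n f x ξ)
    {G : Fin n → (Fin n → ℂ) → ℂ} (hG : ∀ j, IsTest n U (G j)) :
    ∫ x, E * (∑ j, Complex.normSq (G j x)) * wtMult n f x
    ≤ ∫ x, ((1 / 2) * (∑ j, ∑ k, Complex.normSq
          (wd n (-Complex.I) j (fun y => (Real.exp (wtTwist n ψ f y) : ℂ) * G k y) x
            - wd n (-Complex.I) k (fun y => (Real.exp (wtTwist n ψ f y) : ℂ) * G j y) x))
          * Real.exp (-wtMain n ψ f x)
        + 3 * wtMult n f x * Complex.normSq (∑ j, wd n Complex.I j (G j) x)) := by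
  have hG2 : ∀ j, ContDiff ℝ 2 (G j) := fun j => contDiff_infty.1 (hG j).1 2
  have hes : ContDiff ℝ 2 fun y => (Real.exp (wtTwist n ψ f y) : ℂ) :=
    Complex.ofRealCLM.contDiff.comp (contDiff_wtTwist hψ hf).exp
  have hγ : ∀ j, ContDiff ℝ 2 fun y => (Real.exp (wtTwist n ψ f y) : ℂ) * G j y :=
    fun j => hes.mul (hG2 j)
  have hc : ∀ j, HasCompactSupport fun y => (Real.exp (wtTwist n ψ f y) : ℂ) * G j y :=
    fun j => (hG j).2.1.mul_left
  have hφ := contDiff_wtMain hψ hf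
  obtain ⟨hI1, hI2, hle⟩ := integral_hessC_le hφ hγ hc
  have hac := (contDiff_wtMult hf).continuous
  have hJ1 : Integrable fun x => E * (∑ j, Complex.normSq (G j x)) * wtMult n f x := by
    refine Continuous.integrable_of_hasCompactSupport ?_ (HasCompactSupport.intro
      (isCompact_iUnion fun j => (hG j).2.1) fun x hx => ?_)
    · exact (continuous_const.mul (continuous_finsetSum _ fun j _ =>
        Complex.continuous_normSq.comp (hG2 j).continuous)).mul hac
    · simp only [mem_iUnion, not_exists] at hx
      simp [fun j => image_eq_zero_of_notMem_tsupport (hx j)]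
  have hJ2 : Integrable fun x => (1 / 2) * (∑ j, ∑ k, Complex.normSq
          (wd n (-Complex.I) j (fun y => (Real.exp (wtTwist n ψ f y) : ℂ) * G k y) x
            - wd n (-Complex.I) k (fun y => (Real.exp (wtTwist n ψ f y) : ℂ) * G j y) x))
          * Real.exp (-wtMain n ψ f x) := by
    refine Continuous.integrable_of_hasCompactSupport ?_ (HasCompactSupport.intro
      (isCompact_iUnion fun j => hc j) fun x hx => ?_)
    · have h := fun j k => (contDiff_wd (c := -Complex.I) (j := j) (m := 1) (hγ k)
        (by norm_num)).continuous
      exact (continuous_const.mul (continuous_finsetSum _ fun j _ => continuous_finsetSum _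
        fun k _ => Complex.continuous_normSq.comp ((h j k).sub (h k j)))).mul
        hφ.continuous.neg.rexp
    · simp only [mem_iUnion, not_exists] at hx
      simp [-Complex.ofReal_exp, fun j k => wd_eq_zero_of_notMem (c := -Complex.I) (j := j) (hx k)]
  have hJ3 : Integrable fun x => 3 * wtMult n f x *
      Complex.normSq (∑ j, wd n Complex.I j (G j) x) := by
    refine Continuous.integrable_of_hasCompactSupport ?_ (HasCompactSupport.intro
      (isCompact_iUnion fun j => (hG j).2.1) fun x hx => ?_)
    · have h := fun j => (contDiff_wd (c := Complex.I) (j := j) (m := 1) (hG2 j)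
        (by norm_num)).continuous
      exact (continuous_const.mul hac).mul (Complex.continuous_normSq.comp
        (continuous_finsetSum _ fun j _ => h j))
    · simp only [mem_iUnion, not_exists] at hx
      simp [fun j => wd_eq_zero_of_notMem (c := Complex.I) (j := j) (hx j)]
  have key : ∀ x, E * (∑ j, Complex.normSq (G j x)) * wtMult n f x
      + ((1 / 2) * ∑ j, ∑ k, Complex.normSq
          (wd n (-Complex.I) j (fun y => (Real.exp (wtTwist n ψ f y) : ℂ) * G k y) x
            - wd n (-Complex.I) k (fun y => (Real.exp (wtTwist n ψ f y) : ℂ) * G j y) x)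
        + Complex.normSq (∑ j, twistedWd n (wtMain n ψ f) j
          (fun y => (Real.exp (wtTwist n ψ f y) : ℂ) * G j y) x)) * Real.exp (-wtMain n ψ f x)
      ≤ hessC n (wtMain n ψ f) x
          (fun j => (starRingEnd ℂ) ((Real.exp (wtTwist n ψ f x) : ℂ) * G j x))
          * Real.exp (-wtMain n ψ f x)
        + ((1 / 2) * (∑ j, ∑ k, Complex.normSq
          (wd n (-Complex.I) j (fun y => (Real.exp (wtTwist n ψ f y) : ℂ) * G k y) x
            - wd n (-Complex.I) k (fun y => (Real.exp (wtTwist n ψ f y) : ℂ) * G j y) x))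
          * Real.exp (-wtMain n ψ f x)
        + 3 * wtMult n f x * Complex.normSq (∑ j, wd n Complex.I j (G j) x)) := by
    intro x
    rw [sum_twistedWd_eq hψ hf fun j => (hG2 j).differentiable two_ne_zero x]
    simp only [map_mul, Complex.conj_ofReal]
    rw [hessC_mul_real hφ, Complex.normSq_ofReal]
    set ξ : Fin n → ℂ := fun j => (starRingEnd ℂ) (G j x) with hξ
    have hen : ∑ j, Complex.normSq (G j x) = enormSq n ξ := by
      simp [enormSq, hξ, Complex.normSq_conj]
    have hH : hessC n (wtMain n ψ f) x ξ
        = 2 * hessC n ψ x ξ + hessC n (fun x => Real.exp (2 * f x)) x ξ := by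
      rw [← hessC_const_mul 2 hψ, ← hessC_add (contDiff_const.mul hψ)
        (contDiff_const.mul hf).exp]
      rfl
    have hT := normSq_sub_sub_le (∑ j, wd n Complex.I j (G j) x)
      ((starRingEnd ℂ) (delPair n ψ x ξ))
      ((starRingEnd ℂ) (delPair n (fun x => Real.exp (f x)) x ξ))
    rw [Complex.normSq_conj, Complex.normSq_conj] at hT
    have hmain : E * enormSq n ξ + 3 * (Complex.normSq (delPair n ψ x ξ)
        + Complex.normSq (delPair n (fun x => Real.exp (f x)) x ξ))
        ≤ hessC n (wtMain n ψ f) x ξ := by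
      by_cases hx : x ∈ U
      · have := normSq_delPair_exp_le hf (h3 x hx ξ)
        have := Complex.normSq_nonneg (delPair n (fun x => Real.exp (f x)) x ξ)
        linarith [h1 x hx ξ, h2 x hx ξ]
      · have h0 : ξ = 0 := funext fun j => by
          have : x ∉ tsupport (G j) := fun h => hx ((hG j).2.2 h)
          simp [hξ, image_eq_zero_of_notMem_tsupport this]
        rw [h0, delPair_eq_sum (hψ.differentiable two_ne_zero x),
          delPair_eq_sum (hf.exp.differentiable two_ne_zero x), hessC_eq_sum hφ]
        simp [enormSq]
    rw [hen, add_mul, ← wtMult_eq (ψ := ψ) x]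
    have hp := wtMult_pos (f := f) x
    rw [← wtMult_eq (ψ := ψ) x] at hp
    have a1 := mul_le_mul_of_nonneg_left hmain hp.le
    have a2 := mul_le_mul_of_nonneg_left hT hp.le
    linarith
  have hmono := integral_mono (hJ1.add hI2) (hI1.add (hJ2.add hJ3)) key
  rw [integral_add' hJ1 hI2, integral_add' hI1 (hJ2.add hJ3)] at hmono
  exact (add_le_add_iff_right _).1 (hmono.trans ((add_le_add_left hle _).trans
    (add_comm _ _).le))

end Weights

section Duality

lemma exists_inner_repr {H V : Type*} [NormedAddCommGroup H] [InnerProductSpace ℂ H]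
    [CompleteSpace H] [AddCommGroup V] [Module ℂ V] (J : V →ₗ[ℂ] H) (l : V →ₗ[ℂ] ℂ) {C : ℝ}
    (hC : 0 ≤ C) (h : ∀ v, ‖l v‖ ≤ C * ‖J v‖) :
    ∃ x : H, ‖x‖ ≤ C ∧ ∀ v, l v = inner ℂ x (J v) := by
  have hker : LinearMap.ker J ≤ LinearMap.ker l := fun v hv => by
    have := h v
    rw [LinearMap.mem_ker.1 hv, norm_zero, mul_zero] at this
    exact LinearMap.mem_ker.2 (norm_le_zero_iff.1 this)
  let g0 : LinearMap.range J →ₗ[ℂ] ℂ :=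
    ((LinearMap.ker J).liftQ l hker).comp J.quotKerEquivRange.symm.toLinearMap
  have hg0 : ∀ v, g0 ⟨J v, LinearMap.mem_range_self J v⟩ = l v := fun v => by
    have h1 : J.quotKerEquivRange.symm ⟨J v, LinearMap.mem_range_self J v⟩
        = (LinearMap.ker J).mkQ v := J.quotKerEquivRange_symm_apply_image v _
    simp only [g0, LinearMap.comp_apply, LinearEquiv.coe_coe, h1]
    rfl
  let g1 : StrongDual ℂ (LinearMap.range J) := g0.mkContinuous C (by
    rintro ⟨_, v, rfl⟩
    rw [hg0]
    exact h v)
  obtain ⟨g, hg, hgn⟩ := exists_extension_norm_eq (LinearMap.range J) g1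
  refine ⟨(InnerProductSpace.toDual ℂ H).symm g, ?_, fun v => ?_⟩
  · rw [LinearIsometryEquiv.norm_map, hgn]
    exact LinearMap.mkContinuous_norm_le _ hC _
  · rw [InnerProductSpace.toDual_symm_apply]
    exact ((hg ⟨J v, LinearMap.mem_range_self J v⟩).trans (hg0 v)).symm

lemma integral_normSq_eq_norm_sq {Y : Type*} [MeasurableSpace Y] {μ : Measure Y}
    (f : Lp ℂ 2 μ) : ∫ y, Complex.normSq (f y) ∂μ = ‖f‖ ^ 2 := by
  have h := L2.inner_def (𝕜 := ℂ) f f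
  rw [inner_self_eq_norm_sq_to_K] at h
  have h2 : ∫ y, inner ℂ (f y) (f y) ∂μ = ((∫ y, Complex.normSq (f y) ∂μ : ℝ) : ℂ) := by
    refine Eq.trans (integral_congr_ae (Filter.Eventually.of_forall fun y => ?_))
      integral_complex_ofReal
    simp [Complex.normSq_eq_norm_sq]
  rw [h2] at h
  exact Complex.ofReal_injective (h.symm.trans (by norm_cast))

/-- Riesz representation on a finite sum of `L²` spaces, for functionals dominated by a linear
map. -/
lemma exists_memLp_repr {ι Y V : Type*} [Fintype ι] [MeasurableSpace Y] {μ : Measure Y}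
    [AddCommGroup V] [Module ℂ V] (J : ι → V →ₗ[ℂ] (Y → ℂ)) (hJ : ∀ i v, MemLp (J i v) 2 μ)
    (l : V →ₗ[ℂ] ℂ) {C : ℝ} (hC : 0 ≤ C)
    (h : ∀ v, ‖l v‖ ^ 2 ≤ C ^ 2 * ∑ i, ∫ y, Complex.normSq (J i v y) ∂μ) :
    ∃ w : ι → Y → ℂ, (∀ i, MemLp (w i) 2 μ) ∧ ∑ i, ∫ y, Complex.normSq (w i y) ∂μ ≤ C ^ 2 ∧
      ∀ v, l v = ∑ i, ∫ y, w i y * J i v y ∂μ := by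
  let J' : V →ₗ[ℂ] PiLp 2 fun _ : ι => Lp ℂ 2 μ :=
    { toFun := fun v => WithLp.toLp 2 fun i => (hJ i v).toLp _
      map_add' := fun v v' => by
        ext1 i
        change _ = (hJ i v).toLp _ + (hJ i v').toLp _
        rw [← MemLp.toLp_add]
        exact MemLp.toLp_congr (hJ i (v + v')) ((hJ i v).add (hJ i v')) (by rw [map_add])
      map_smul' := fun a v => by
        ext1 i
        change _ = a • (hJ i v).toLp _
        rw [← MemLp.toLp_const_smul]
        exact MemLp.toLp_congr (hJ i (a • v)) ((hJ i v).const_smul a) (by rw [map_smul]) }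
  have hJ' : ∀ v i, (J' v) i = (hJ i v).toLp _ := fun _ _ => rfl
  have hn : ∀ v, ‖J' v‖ ^ 2 = ∑ i, ∫ y, Complex.normSq (J i v y) ∂μ := fun v => by
    rw [PiLp.norm_sq_eq_of_L2]
    refine Finset.sum_congr rfl fun i _ => ?_
    rw [hJ', ← integral_normSq_eq_norm_sq]
    refine integral_congr_ae ?_
    filter_upwards [(hJ i v).coeFn_toLp] with y hy
    rw [hy]
  obtain ⟨x, hx, hl⟩ := exists_inner_repr J' l hC fun v => by
    refine abs_le_of_sq_le_sq' ?_ (by positivity) |>.2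
    rw [mul_pow, hn]
    exact h v
  refine ⟨fun i y => (starRingEnd ℂ) (x i y), fun i => (Lp.memLp (x i)).star, ?_, fun v => ?_⟩
  · have h1 := PiLp.norm_sq_eq_of_L2 (fun _ : ι => Lp ℂ 2 μ) x
    simp only [Complex.normSq_conj, integral_normSq_eq_norm_sq]
    rw [← h1]
    gcongr
  · rw [hl, PiLp.inner_apply]
    refine Finset.sum_congr rfl fun i _ => ?_
    rw [L2.inner_def, hJ']
    refine integral_congr_ae ?_
    filter_upwards [(hJ i v).coeFn_toLp] with y hy
    rw [hy]
    simp [mul_comm]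

end Duality

section Mollification

/-- A smooth even probability density supported in the ball of radius `r`. -/
structure IsMollifier (n : ℕ) (k : (Fin n → ℂ) → ℝ) (r : ℝ) : Prop where
  smooth : ContDiff ℝ (⊤ : ℕ∞) k
  nonneg : ∀ x, 0 ≤ k x
  integral_eq_one : ∫ x, k x = 1
  even : ∀ x, k (-x) = k x
  support : tsupport k ⊆ closedBall 0 r

lemma exists_isMollifier (n : ℕ) {r : ℝ} (hr : 0 < r) : ∃ k, IsMollifier n k r := by
  let b : ContDiffBump (0 : Fin n → ℂ) := ⟨r / 2, r, by linarith, by linarith⟩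
  refine ⟨b.normed volume, b.contDiff_normed, b.nonneg_normed, b.integral_normed,
    fun x => b.normed_neg x, ?_⟩
  rw [b.tsupport_normed_eq]

/-- Convolution of `f` with the kernel `k`. -/
def moll {𝕜 : Type*} [RCLike 𝕜] (n : ℕ) (k : (Fin n → ℂ) → ℝ) (f : (Fin n → ℂ) → 𝕜)
    (x : Fin n → ℂ) : 𝕜 :=
  ∫ y, k (x - y) • f y

variable {n : ℕ} {𝕜 : Type*} [RCLike 𝕜] {k : (Fin n → ℂ) → ℝ} {r : ℝ}

namespace IsMollifier

lemma eq_zero (hk : IsMollifier n k r) {x : Fin n → ℂ} (hx : r < ‖x‖) : k x = 0 :=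
  image_eq_zero_of_notMem_tsupport fun h => by
    have := hk.support h
    rw [mem_closedBall_zero_iff] at this
    linarith

lemma hasCompactSupport (hk : IsMollifier n k r) : HasCompactSupport k :=
  (isCompact_closedBall 0 r).of_isClosed_subset (isClosed_tsupport k) hk.support

lemma continuous (hk : IsMollifier n k r) : Continuous k := hk.smooth.continuous

lemma integrable (hk : IsMollifier n k r) : Integrable k :=
  hk.continuous.integrable_of_hasCompactSupport hk.hasCompactSupport

lemma exists_bound (hk : IsMollifier n k r) : ∃ C, ∀ x, ‖k x‖ ≤ C :=
  hk.hasCompactSupport.exists_bound_of_continuous hk.continuous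

lemma integrable_smul (hk : IsMollifier n k r) {f : (Fin n → ℂ) → 𝕜} (hf : Integrable f)
    (x : Fin n → ℂ) : Integrable fun y => k (x - y) • f y := by
  obtain ⟨C, hC⟩ := hk.exists_bound
  exact hf.bdd_smul C (hk.continuous.comp (continuous_const.sub continuous_id)).aestronglyMeasurable
    (Filter.Eventually.of_forall fun y => hC _)

lemma integral_sub_eq_one (hk : IsMollifier n k r) (x : Fin n → ℂ) :
    ∫ y, k (x - y) = 1 := by
  rw [integral_sub_left_eq_self k volume x, hk.integral_eq_one]

lemma integrable_sub (hk : IsMollifier n k r) (x : Fin n → ℂ) :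
    Integrable fun y => k (x - y) := hk.integrable.comp_sub_left x

lemma norm_integral_le (hk : IsMollifier n k r) {h : (Fin n → ℂ) → 𝕜} {δ : ℝ} (x : Fin n → ℂ)
    (hd : ∀ y, ‖x - y‖ ≤ r → ‖h y‖ ≤ δ) : ‖∫ y, k (x - y) • h y‖ ≤ δ := by
  have h1 : ‖∫ y, k (x - y) • h y‖ ≤ ∫ y, k (x - y) * δ := by
    refine norm_integral_le_of_norm_le ((hk.integrable_sub x).mul_const δ)
      (Filter.Eventually.of_forall fun y => ?_)
    rw [norm_smul, Real.norm_of_nonneg (hk.nonneg _)]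
    by_cases hy : ‖x - y‖ ≤ r
    · exact mul_le_mul_of_nonneg_left (hd y hy) (hk.nonneg _)
    · simp [hk.eq_zero (not_le.1 hy)]
  rwa [integral_mul_const, hk.integral_sub_eq_one, one_mul] at h1

lemma norm_moll_sub_le (hk : IsMollifier n k r) {g : (Fin n → ℂ) → 𝕜} (hg : Continuous g)
    {δ : ℝ} (x : Fin n → ℂ) (hd : ∀ y, ‖x - y‖ ≤ r → ‖g y - g x‖ ≤ δ) :
    ‖moll n k g x - g x‖ ≤ δ := by
  have h1 : Integrable fun y => k (x - y) • g y :=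
    ((hk.continuous.comp (continuous_const.sub continuous_id)).smul hg
      ).integrable_of_hasCompactSupport
      (hk.hasCompactSupport.comp_homeomorph (Homeomorph.subLeft x)).smul_right
  have h2 : moll n k g x - g x = ∫ y, k (x - y) • (g y - g x) := by
    simp only [smul_sub]
    rw [integral_sub h1 ((hk.integrable_sub x).smul_const _), integral_smul_const,
      hk.integral_sub_eq_one, one_smul, moll]
  rw [h2]
  exact hk.norm_integral_le x hd

lemma integral_moll_mul (hk : IsMollifier n k r) {f g : (Fin n → ℂ) → 𝕜} (hf : Integrable f)
    (hg : Integrable g) : ∫ x, moll n k f x * g x = ∫ y, f y * moll n k g y := by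
  have h1 : ∀ x, moll n k f x * g x = ∫ y, k (x - y) • (g x * f y) := fun x => by
    rw [moll, ← integral_mul_const]
    refine integral_congr_ae (Filter.Eventually.of_forall fun y => ?_)
    simp only
    rw [smul_mul_assoc, mul_comm]
  have h2 : ∀ y, f y * moll n k g y = ∫ x, k (x - y) • (g x * f y) := fun y => by
    rw [moll, ← integral_const_mul]
    refine integral_congr_ae (Filter.Eventually.of_forall fun x => ?_)
    simp only
    rw [← hk.even (x - y), neg_sub, mul_smul_comm, mul_comm (f y)]
  simp only [h1, h2]
  refine integral_integral_swap ?_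
  obtain ⟨C, hC⟩ := hk.exists_bound
  exact (hg.mul_prod hf).bdd_smul C
    (hk.continuous.comp (continuous_fst.sub continuous_snd)).aestronglyMeasurable
    (Filter.Eventually.of_forall fun y => hC _)

lemma moll_eq_convolution (k : (Fin n → ℂ) → ℝ) (f : (Fin n → ℂ) → 𝕜) :
    moll n k f = MeasureTheory.convolution f k (ContinuousLinearMap.lsmul ℝ ℝ).flip volume :=
  rfl

lemma contDiff_moll (hk : IsMollifier n k r) {f : (Fin n → ℂ) → 𝕜} (hf : LocallyIntegrable f) :
    ContDiff ℝ (⊤ : ℕ∞) (moll n k f) := by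
  rw [moll_eq_convolution]
  exact hk.hasCompactSupport.contDiff_convolution_right _ hf hk.smooth

lemma fderiv_moll_apply (hk : IsMollifier n k r) {f : (Fin n → ℂ) → 𝕜}
    (hf : LocallyIntegrable f) (x v : Fin n → ℂ) :
    fderiv ℝ (moll n k f) x v = ∫ y, fderiv ℝ k (x - y) v • f y := by
  have hk1 : ContDiff ℝ 1 k := contDiff_infty.1 hk.smooth 1
  have h := hk.hasCompactSupport.hasFDerivAt_convolution_right
    (ContinuousLinearMap.lsmul ℝ ℝ (E := 𝕜)).flip hf hk1 x
  rw [moll_eq_convolution, h.fderiv, convolution_precompR_apply _ hf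
    (hk.hasCompactSupport.fderiv ℝ) (hk1.continuous_fderiv one_ne_zero)]
  rfl

lemma norm_integral_moll_mul_sub_le (hk : IsMollifier n k r) {f g : (Fin n → ℂ) → 𝕜}
    (hf : Integrable f) (hg : Continuous g) (hgc : HasCompactSupport g) {δ : ℝ}
    (hd : ∀ x y, ‖x - y‖ ≤ r → ‖g y - g x‖ ≤ δ) :
    ‖(∫ x, moll n k f x * g x) - ∫ x, f x * g x‖ ≤ δ * ∫ x, ‖f x‖ := by
  have hgi := hg.integrable_of_hasCompactSupport (μ := volume) hgc
  have hle := fun x => hk.norm_moll_sub_le hg x (hd x)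
  obtain ⟨C, hC⟩ := hgc.exists_bound_of_continuous hg
  have h1 : Integrable fun x => f x * g x :=
    hf.mul_bdd (c := C) hg.aestronglyMeasurable (Filter.Eventually.of_forall hC)
  have h2 : Integrable fun x => f x * moll n k g x := by
    refine hf.mul_bdd (c := δ + C) (hk.contDiff_moll hgi.locallyIntegrable
      ).continuous.aestronglyMeasurable (Filter.Eventually.of_forall fun x => ?_)
    calc ‖moll n k g x‖ = ‖(moll n k g x - g x) + g x‖ := by rw [sub_add_cancel]
      _ ≤ _ := (norm_add_le _ _).trans (add_le_add (hle x) (hC x))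
  rw [hk.integral_moll_mul hf hgi, ← integral_sub h2 h1, ← integral_const_mul]
  refine norm_integral_le_of_norm_le (hf.norm.const_mul δ)
    (Filter.Eventually.of_forall fun x => ?_)
  rw [← mul_sub, norm_mul, mul_comm]
  exact mul_le_mul_of_nonneg_right (hle x) (norm_nonneg _)

lemma sq_integral_le (hk : IsMollifier n k r) {h : (Fin n → ℂ) → ℝ} (h1 : Integrable h)
    (h2 : Integrable fun y => h y ^ 2) (x : Fin n → ℂ) :
    (∫ y, k (x - y) • h y) ^ 2 ≤ moll n k (fun y => h y ^ 2) x := by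
  set t := ∫ y, k (x - y) • h y with ht
  have i1 := hk.integrable_smul h1 x
  have i2 := hk.integrable_smul h2 x
  have h3 : 0 ≤ ∫ y, k (x - y) * (h y - t) ^ 2 :=
    integral_nonneg fun y => mul_nonneg (hk.nonneg _) (sq_nonneg _)
  have h4 : ∫ y, k (x - y) * (h y - t) ^ 2
      = ∫ y, (k (x - y) • h y ^ 2 - 2 * t * k (x - y) • h y + t ^ 2 * k (x - y)) := by
    refine integral_congr_ae (Filter.Eventually.of_forall fun y => ?_)
    simp only [smul_eq_mul]
    ring
  have i3 : Integrable fun y => 2 * t * k (x - y) • h y := i1.const_mul _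
  have i4 : Integrable fun y => t ^ 2 * k (x - y) := (hk.integrable_sub x).const_mul _
  have i5 : Integrable fun y => k (x - y) • h y ^ 2 - 2 * t * k (x - y) • h y := i2.sub i3
  rw [h4, integral_add i5 i4, integral_sub i2 i3, integral_const_mul, integral_const_mul,
    hk.integral_sub_eq_one, ← ht] at h3
  change t ^ 2 ≤ ∫ y, k (x - y) • h y ^ 2
  linarith

lemma normSq_integral_smul_mul_le (hk : IsMollifier n k r) {b Z : (Fin n → ℂ) → ℂ}
    (hZ : Integrable Z) (hZ2 : Integrable fun y => Complex.normSq (Z y)) {δ : ℝ}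
    (x : Fin n → ℂ) (hb : ∀ y, ‖x - y‖ ≤ r → ‖b y‖ ≤ δ) :
    Complex.normSq (∫ y, k (x - y) • (b y * Z y))
      ≤ δ ^ 2 * moll n k (fun y => Complex.normSq (Z y)) x := by
  have hn : (fun y => Complex.normSq (Z y)) = fun y => ‖Z y‖ ^ 2 :=
    funext fun y => Complex.normSq_eq_norm_sq _
  have h1 : ‖∫ y, k (x - y) • (b y * Z y)‖ ≤ ∫ y, δ * k (x - y) • ‖Z y‖ := by
    refine norm_integral_le_of_norm_le ((hk.integrable_smul hZ.norm x).const_mul δ)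
      (Filter.Eventually.of_forall fun y => ?_)
    rw [norm_smul, norm_mul, Real.norm_of_nonneg (hk.nonneg _), smul_eq_mul]
    by_cases hy : ‖x - y‖ ≤ r
    · have := mul_le_mul_of_nonneg_right (hb y hy)
        (mul_nonneg (hk.nonneg (x - y)) (norm_nonneg (Z y)))
      linarith
    · simp [hk.eq_zero (not_le.1 hy)]
  rw [integral_const_mul] at h1
  rw [hn] at hZ2 ⊢
  rw [Complex.normSq_eq_norm_sq]
  calc _ ≤ (δ * ∫ y, k (x - y) • ‖Z y‖) ^ 2 := by gcongr
    _ ≤ _ := by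
      rw [mul_pow]
      exact mul_le_mul_of_nonneg_left (hk.sq_integral_le hZ.norm hZ2 x) (sq_nonneg _)

end IsMollifier

end Mollification

section CauchySchwarz

lemma normSq_sum_mul_le {ι : Type*} (t : Finset ι) (a b : ι → ℂ) :
    Complex.normSq (∑ i ∈ t, a i * b i)
      ≤ (∑ i ∈ t, Complex.normSq (a i)) * ∑ i ∈ t, Complex.normSq (b i) := by
  have h := Finset.sum_mul_sq_le_sq_mul_sq t (fun i => ‖a i‖) (fun i => ‖b i‖)
  simp only [Complex.normSq_eq_norm_sq]
  refine le_trans ?_ h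
  gcongr
  exact (norm_sum_le _ _).trans (by simp)

lemma normSq_integral_le {Y : Type*} [MeasurableSpace Y] {μ : Measure Y} {F : Y → ℂ}
    {A B : Y → ℝ} (hA : Integrable A μ) (hB : Integrable B μ) (hF : Integrable F μ)
    (hA0 : ∀ y, 0 ≤ A y) (hB0 : ∀ y, 0 ≤ B y)
    (h : ∀ y, Complex.normSq (F y) ≤ A y * B y) :
    Complex.normSq (∫ y, F y ∂μ) ≤ (∫ y, A y ∂μ) * ∫ y, B y ∂μ := by
  have h1 : ∀ t : ℝ, 0 ≤ (∫ y, A y ∂μ) * (t * t) + (-2 * ∫ y, ‖F y‖ ∂μ) * t + ∫ y, B y ∂μ := by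
    intro t
    have i1 : Integrable (fun y => t * t * A y) μ := hA.const_mul _
    have i2 : Integrable (fun y => 2 * t * ‖F y‖) μ := hF.norm.const_mul _
    have i3 : Integrable (fun y => t * t * A y - 2 * t * ‖F y‖) μ := i1.sub i2
    have h2 : 0 ≤ ∫ y, (t * t * A y - 2 * t * ‖F y‖ + B y) ∂μ := by
      refine integral_nonneg fun y => ?_
      have h3 := h y
      rw [Complex.normSq_eq_norm_sq] at h3
      have h4 : (2 * t * ‖F y‖) ^ 2 ≤ (t * t * A y + B y) ^ 2 := by
        nlinarith [sq_nonneg (t * t * A y - B y), mul_le_mul_of_nonneg_left h3 (sq_nonneg t)]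
      have h5 : 0 ≤ t * t * A y + B y :=
        add_nonneg (mul_nonneg (mul_self_nonneg t) (hA0 y)) (hB0 y)
      have h6 := abs_le_of_sq_le_sq' h4 h5
      simp only [Pi.zero_apply]
      linarith [h6.2]
    rw [integral_add i3 hB, integral_sub i1 i2, integral_const_mul, integral_const_mul] at h2
    linarith
  have h2 := discrim_le_zero h1
  rw [discrim] at h2
  have h3 : ‖∫ y, F y ∂μ‖ ^ 2 ≤ (∫ y, ‖F y‖ ∂μ) ^ 2 := by
    gcongr
    exact norm_integral_le_integral_norm _
  rw [Complex.normSq_eq_norm_sq]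
  linarith

end CauchySchwarz

section Caccioppoli

variable {n : ℕ}

lemma caccioppoli_smooth {V : (Fin n → ℂ) → ℂ} {Z : Fin n → Fin n → (Fin n → ℂ) → ℂ}
    {s χ : (Fin n → ℂ) → ℝ} {R : Fin n → (Fin n → ℂ) → ℂ} (hV : ContDiff ℝ 3 V)
    (hZ : ∀ j l, ContDiff ℝ 1 (Z j l)) (hanti : ∀ j l x, Z l j x = -Z j l x)
    (hs : ContDiff ℝ 2 s) (hχ : ContDiff ℝ 2 χ) (hχc : HasCompactSupport χ)
    (hR : ∀ l x, R l x = wd n Complex.I l V x - ∑ j, (wd n (-Complex.I) j (Z j l) x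
      - wd n (-Complex.I) j (fun y => (s y : ℂ)) x * Z j l x)) :
    (Integrable fun x => χ x ^ 2 * Real.exp (-s x)
      * ∑ l, Complex.normSq (wd n Complex.I l V x)) ∧
    (Integrable fun x => Real.exp (-s x) * ∑ l, Complex.normSq ((χ x : ℂ) * R l x
        - 2 * ∑ j, wd n (-Complex.I) j (fun y => (χ y : ℂ)) x * Z j l x)) ∧
    ∫ x, χ x ^ 2 * Real.exp (-s x) * ∑ l, Complex.normSq (wd n Complex.I l V x)
    ≤ ∫ x, Real.exp (-s x) * ∑ l, Complex.normSq ((χ x : ℂ) * R l x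
        - 2 * ∑ j, wd n (-Complex.I) j (fun y => (χ y : ℂ)) x * Z j l x) := by
  have hV2 : ContDiff ℝ 2 V := hV.of_le (by norm_num)
  have hχ' : ContDiff ℝ 2 fun x => (χ x : ℂ) := Complex.ofRealCLM.contDiff.comp hχ
  have hs' : ContDiff ℝ 2 fun x => (s x : ℂ) := Complex.ofRealCLM.contDiff.comp hs
  have hE : ContDiff ℝ 2 fun x => Complex.exp (-(s x : ℂ)) := contDiff_cexp_neg hs
  have hT : ∀ l, ContDiff ℝ 2 (wd n Complex.I l V) := fun l => contDiff_wd hV (by norm_num)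
  have hTs : ∀ l, ContDiff ℝ 2 fun x => (starRingEnd ℂ) (wd n Complex.I l V x) := fun l =>
    (Complex.conjCLE : ℂ →L[ℝ] ℂ).contDiff.comp (hT l)
  have hRc : ∀ l, Continuous (R l) := fun l => by
    rw [funext (hR l)]
    refine (hT l).continuous.sub (continuous_finsetSum _ fun j _ => ?_)
    exact (contDiff_wd (m := 0) (hZ j l) (by simp)).continuous.sub
      ((contDiff_wd (m := 1) hs' (by norm_num)).continuous.mul (hZ j l).continuous)
  set P : Fin n → Fin n → (Fin n → ℂ) → ℂ := fun j l x => (χ x : ℂ) * ((χ x : ℂ)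
    * ((starRingEnd ℂ) (wd n Complex.I l V x) * (Complex.exp (-(s x : ℂ)) * Z j l x))) with hP
  have hPc : ∀ j l, ContDiff ℝ 1 (P j l) := fun j l =>
    (hχ'.of_le (by norm_num)).mul ((hχ'.of_le (by norm_num)).mul
      (((hTs l).of_le (by norm_num)).mul ((hE.of_le (by norm_num)).mul (hZ j l))))
  have hχs : HasCompactSupport fun x => (χ x : ℂ) :=
    hχc.comp_left (g := fun t : ℝ => (t : ℂ)) Complex.ofReal_zero
  have hPs : ∀ j l, HasCompactSupport (P j l) := fun j l => hχs.mul_right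
  have hPi : ∀ j l, Integrable (wd n (-Complex.I) j (P j l)) := fun j l =>
    (contDiff_wd (m := 0) (hPc j l) (by simp)).continuous.integrable_of_hasCompactSupport
      (hPs j l).wd
  have i1 : Integrable fun x => χ x ^ 2 * Real.exp (-s x)
      * ∑ l, Complex.normSq (wd n Complex.I l V x) := by
    refine Continuous.integrable_of_hasCompactSupport ?_ (HasCompactSupport.intro hχc
      fun x hx => ?_)
    · exact ((hχ.continuous.pow 2).mul hs.continuous.neg.rexp).mul (continuous_finsetSum _
        fun l _ => Complex.continuous_normSq.comp (hT l).continuous)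
    · simp [image_eq_zero_of_notMem_tsupport hx]
  have hsub : tsupport (fun x => (χ x : ℂ)) ⊆ tsupport χ := by
    refine closure_mono fun x hx hx' => hx ?_
    simp [hx']
  have i2 : Integrable fun x => Real.exp (-s x) * ∑ l, Complex.normSq ((χ x : ℂ) * R l x
        - 2 * ∑ j, wd n (-Complex.I) j (fun y => (χ y : ℂ)) x * Z j l x) := by
    refine Continuous.integrable_of_hasCompactSupport ?_ (HasCompactSupport.intro hχc
      fun x hx => ?_)
    · refine hs.continuous.neg.rexp.mul (continuous_finsetSum _ fun l _ =>
        Complex.continuous_normSq.comp ((hχ'.continuous.mul (hRc l)).sub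
          (continuous_const.mul (continuous_finsetSum _ fun j _ => Continuous.mul ?_
            (hZ j l).continuous))))
      exact (contDiff_wd (m := 1) hχ' (by norm_num)).continuous
    · have h1 : ∀ j, wd n (-Complex.I) j (fun y => (χ y : ℂ)) x = 0 := fun j =>
        wd_eq_zero_of_notMem fun h => hx (hsub h)
      simp [image_eq_zero_of_notMem_tsupport hx, h1]
  have i3 : Integrable fun x => 2 * (∑ l, ∑ j, wd n (-Complex.I) j (P j l) x).re :=
    ((integrable_finsetSum _ fun l _ => integrable_finsetSum _ fun j _ => hPi j l).re).const_mul 2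
  have hdiv : ∫ x, (∑ l, ∑ j, wd n (-Complex.I) j (P j l) x).re = 0 := by
    have hi2 : ∀ l, Integrable fun x => ∑ j, wd n (-Complex.I) j (P j l) x :=
      fun l => integrable_finsetSum _ fun j _ => hPi j l
    have h0 : ∫ x, (∑ l, ∑ j, wd n (-Complex.I) j (P j l) x) = 0 := by
      rw [integral_finsetSum _ fun l _ => hi2 l]
      refine Finset.sum_eq_zero fun l _ => ?_
      rw [integral_finsetSum _ fun j _ => hPi j l]
      exact Finset.sum_eq_zero fun j _ => integral_wd_eq_zero (hPc j l) (hPs j l)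
    have := integral_re (𝕜 := ℂ) (integrable_finsetSum Finset.univ fun l _ => hi2 l)
    exact this.trans (by rw [h0]; rfl)
  have hPd : ∀ j l x, wd n (-Complex.I) j (P j l) x
      = Complex.exp (-(s x : ℂ)) * (2 * (χ x : ℂ) * wd n (-Complex.I) j (fun y => (χ y : ℂ)) x
          * (starRingEnd ℂ) (wd n Complex.I l V x) * Z j l x
        + (χ x : ℂ) ^ 2 * (starRingEnd ℂ) (wd n Complex.I j (wd n Complex.I l V) x) * Z j l x
        + (χ x : ℂ) ^ 2 * (starRingEnd ℂ) (wd n Complex.I l V x)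
          * (wd n (-Complex.I) j (Z j l) x
            - wd n (-Complex.I) j (fun y => (s y : ℂ)) x * Z j l x)) := by
    intro j l x
    have d1 : DifferentiableAt ℝ (fun x => (χ x : ℂ)) x := hχ'.differentiable two_ne_zero x
    have d2 : DifferentiableAt ℝ (fun x => (starRingEnd ℂ) (wd n Complex.I l V x)) x :=
      (hTs l).differentiable two_ne_zero x
    have d3 : DifferentiableAt ℝ (fun x => Complex.exp (-(s x : ℂ))) x :=
      hE.differentiable two_ne_zero x
    have d4 : DifferentiableAt ℝ (Z j l) x := (hZ j l).differentiable one_ne_zero x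
    have d5 : DifferentiableAt ℝ (fun x => Complex.exp (-(s x : ℂ)) * Z j l x) x := d3.mul d4
    have d6 : DifferentiableAt ℝ (fun x => (starRingEnd ℂ) (wd n Complex.I l V x)
      * (Complex.exp (-(s x : ℂ)) * Z j l x)) x := d2.mul d5
    have d7 : DifferentiableAt ℝ (fun x => (χ x : ℂ) * ((starRingEnd ℂ) (wd n Complex.I l V x)
      * (Complex.exp (-(s x : ℂ)) * Z j l x))) x := d1.mul d6
    have d8 : DifferentiableAt ℝ (fun x => -(s x : ℂ)) x :=
      (hs'.differentiable two_ne_zero x).neg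
    rw [hP, wd_mul d1 d7, wd_mul d1 d6, wd_mul d2 d5, wd_mul d3 d4, wd_exp d8, wd_neg,
      wd_star ((hT l).differentiable two_ne_zero x)]
    simp only [map_neg, Complex.conj_I, neg_neg]
    ring
  have hcancel : ∀ x, ∑ l, ∑ j, (starRingEnd ℂ) (wd n Complex.I j (wd n Complex.I l V) x)
      * Z j l x = 0 := by
    intro x
    have h1 : ∑ l, ∑ j, (starRingEnd ℂ) (wd n Complex.I j (wd n Complex.I l V) x) * Z j l x
        = -∑ l, ∑ j, (starRingEnd ℂ) (wd n Complex.I j (wd n Complex.I l V) x) * Z j l x := by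
      conv_lhs => rw [Finset.sum_comm]
      rw [← Finset.sum_neg_distrib]
      refine Finset.sum_congr rfl fun l _ => ?_
      rw [← Finset.sum_neg_distrib]
      refine Finset.sum_congr rfl fun j _ => ?_
      rw [hanti, wd_comm hV2]
      ring
    exact self_eq_neg.1 h1
  have key : ∀ x, χ x ^ 2 * Real.exp (-s x) * ∑ l, Complex.normSq (wd n Complex.I l V x)
      ≤ Real.exp (-s x) * ∑ l, Complex.normSq ((χ x : ℂ) * R l x
        - 2 * ∑ j, wd n (-Complex.I) j (fun y => (χ y : ℂ)) x * Z j l x)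
        + 2 * (∑ l, ∑ j, wd n (-Complex.I) j (P j l) x).re := by
    intro x
    set T := fun l => wd n Complex.I l V x with hTd
    set Q : Fin n → ℂ := fun l => (χ x : ℂ) * R l x
        - 2 * ∑ j, wd n (-Complex.I) j (fun y => (χ y : ℂ)) x * Z j l x with hQd
    have h1 : ∑ l, ∑ j, wd n (-Complex.I) j (P j l) x
        = (Real.exp (-s x) : ℂ) * ∑ l, ((χ x : ℂ) ^ 2 * (T l * (starRingEnd ℂ) (T l))
          - (χ x : ℂ) * (starRingEnd ℂ) (T l) * Q l) := by
      have h2 : ∀ l, ∑ j, wd n (-Complex.I) j (P j l) x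
          = (Real.exp (-s x) : ℂ) * (((χ x : ℂ) ^ 2 * (T l * (starRingEnd ℂ) (T l))
          - (χ x : ℂ) * (starRingEnd ℂ) (T l) * Q l)
          + (χ x : ℂ) ^ 2 * ∑ j, (starRingEnd ℂ) (wd n Complex.I j (wd n Complex.I l V) x)
            * Z j l x) := by
        intro l
        have e1 : ∑ j, (wd n (-Complex.I) j (Z j l) x
            - wd n (-Complex.I) j (fun y => (s y : ℂ)) x * Z j l x) = T l - R l x := by
          rw [hR]; ring
        have e2 : 2 * ∑ j, wd n (-Complex.I) j (fun y => (χ y : ℂ)) x * Z j l x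
            = (χ x : ℂ) * R l x - Q l := by rw [hQd]; ring
        have e3 : ∑ j, wd n (-Complex.I) j (P j l) x = Complex.exp (-(s x : ℂ))
            * ((χ x : ℂ) * (starRingEnd ℂ) (T l)
              * (2 * ∑ j, wd n (-Complex.I) j (fun y => (χ y : ℂ)) x * Z j l x)
            + (χ x : ℂ) ^ 2 * ∑ j, (starRingEnd ℂ) (wd n Complex.I j (wd n Complex.I l V) x)
              * Z j l x
            + (χ x : ℂ) ^ 2 * (starRingEnd ℂ) (T l) * ∑ j, (wd n (-Complex.I) j (Z j l) x
              - wd n (-Complex.I) j (fun y => (s y : ℂ)) x * Z j l x)) := by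
          simp only [Finset.mul_sum, ← Finset.sum_add_distrib]
          refine Finset.sum_congr rfl fun j _ => ?_
          rw [hPd]
          ring
        rw [e3, e1, e2]
        push_cast
        ring
      rw [Finset.sum_congr rfl fun l _ => h2 l, ← Finset.mul_sum, Finset.sum_add_distrib,
        ← Finset.mul_sum, hcancel, mul_zero, add_zero]
    rw [h1, Complex.re_ofReal_mul, Complex.re_sum]
    have h3 : ∀ l, 2 * ((χ x : ℂ) ^ 2 * (T l * (starRingEnd ℂ) (T l))
          - (χ x : ℂ) * (starRingEnd ℂ) (T l) * Q l).re
        ≥ χ x ^ 2 * Complex.normSq (T l) - Complex.normSq (Q l) := by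
      intro l
      rw [Complex.mul_conj, ← Complex.ofReal_pow, ← Complex.ofReal_mul, Complex.sub_re,
        Complex.ofReal_re, mul_assoc, Complex.re_ofReal_mul]
      simp only [Complex.normSq_apply, Complex.mul_re, Complex.conj_re, Complex.conj_im]
      nlinarith [sq_nonneg (χ x * (T l).re - (Q l).re), sq_nonneg (χ x * (T l).im - (Q l).im)]
    have h4 := Finset.sum_le_sum fun l (_ : l ∈ Finset.univ) => h3 l
    rw [Finset.sum_sub_distrib, ← Finset.mul_sum, ← Finset.mul_sum] at h4
    have h5 := mul_le_mul_of_nonneg_left h4 (Real.exp_pos (-s x)).le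
    linarith
  refine ⟨i1, i2, ?_⟩
  have hmono := integral_mono i1 (i2.add i3) key
  rw [integral_add' i2 i3, integral_const_mul, hdiv] at hmono
  linarith

end Caccioppoli

section SmoothedEquation

variable {n : ℕ} {k : (Fin n → ℂ) → ℝ} {r : ℝ} {c : ℂ} {j : Fin n}

lemma wd_ofReal_eq {g : (Fin n → ℂ) → ℝ} {z : Fin n → ℂ} (hg : DifferentiableAt ℝ g z) :
    wd n c j (fun x => (g x : ℂ)) z = (1 / 2) * ((fderiv ℝ g z (Pi.single j 1) : ℂ)
      + c * (fderiv ℝ g z (Pi.single j Complex.I) : ℂ)) := by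
  have h : HasFDerivAt (fun x => (g x : ℂ)) (Complex.ofRealCLM.comp (fderiv ℝ g z)) z :=
    Complex.ofRealCLM.hasFDerivAt.comp z hg.hasFDerivAt
  simp [wd, h.fderiv]

lemma wd_comp_sub_left {h : (Fin n → ℂ) → ℂ} {x y : Fin n → ℂ}
    (hh : DifferentiableAt ℝ h (x - y)) :
    wd n c j (fun y => h (x - y)) y = -wd n c j h (x - y) := by
  have h1 : HasFDerivAt (fun y => h (x - y))
      ((fderiv ℝ h (x - y)).comp (-ContinuousLinearMap.id ℝ (Fin n → ℂ))) y :=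
    hh.hasFDerivAt.comp y ((hasFDerivAt_id y).const_sub x)
  simp only [wd, h1.fderiv, ContinuousLinearMap.comp_neg, ContinuousLinearMap.comp_id,
    _root_.neg_apply]
  ring

lemma IsMollifier.wd_moll (hk : IsMollifier n k r) {F : (Fin n → ℂ) → ℂ} (hF : Integrable F)
    (x : Fin n → ℂ) :
    (Integrable fun y => F y * wd n c j (fun y => (k y : ℂ)) (x - y)) ∧
    wd n c j (moll n k F) x = ∫ y, F y * wd n c j (fun y => (k y : ℂ)) (x - y) := by
  have hk1 : ContDiff ℝ 1 k := contDiff_infty.1 hk.smooth 1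
  have hi : ∀ v, Integrable fun y => fderiv ℝ k (x - y) v • F y := fun v => by
    have hc : Continuous fun z => fderiv ℝ k z v := by
      have := hk1.continuous_fderiv one_ne_zero
      fun_prop
    obtain ⟨C, hC⟩ := (hk.hasCompactSupport.fderiv_apply ℝ v).exists_bound_of_continuous hc
    exact hF.bdd_smul C (hc.comp (continuous_const.sub continuous_id)).aestronglyMeasurable
      (Filter.Eventually.of_forall fun y => hC _)
  have he : (fun y => F y * wd n c j (fun y => (k y : ℂ)) (x - y))
      = fun y => (1 / 2) * (fderiv ℝ k (x - y) (Pi.single j 1) • F y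
        + c * fderiv ℝ k (x - y) (Pi.single j Complex.I) • F y) := by
    funext y
    rw [wd_ofReal_eq (hk1.differentiable one_ne_zero _), Complex.real_smul, Complex.real_smul]
    ring
  rw [he]
  refine ⟨((hi _).add ((hi _).const_mul c)).const_mul _, ?_⟩
  rw [integral_const_mul, integral_add (hi _) ((hi _).const_mul c), integral_const_mul, wd,
    hk.fderiv_moll_apply hF.locallyIntegrable, hk.fderiv_moll_apply hF.locallyIntegrable]

lemma IsMollifier.isTest (hk : IsMollifier n k r) {U : Set (Fin n → ℂ)} {x : Fin n → ℂ}
    (hx : closedBall x r ⊆ U) : IsTest n U fun y => (k (x - y) : ℂ) := by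
  have hs : tsupport (fun y => (k (x - y) : ℂ)) ⊆ closedBall x r := by
    refine closure_minimal (fun y hy => ?_) isClosed_closedBall
    by_contra h
    refine hy ?_
    rw [mem_closedBall, dist_comm, dist_eq_norm, not_le] at h
    simp [hk.eq_zero h]
  refine ⟨Complex.ofRealCLM.contDiff.comp (hk.smooth.comp (contDiff_const.sub contDiff_id)),
    (isCompact_closedBall x r).of_isClosed_subset (isClosed_tsupport _) hs, hs.trans hx⟩

lemma IsMollifier.wd_moll_eq (hk : IsMollifier n k r) {U : Set (Fin n → ℂ)}
    {V : (Fin n → ℂ) → ℂ} {Z b : Fin n → (Fin n → ℂ) → ℂ} {l : Fin n} (hV : Integrable V)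
    (hZ : ∀ j, Integrable (Z j)) (hb : ∀ j, Continuous (b j))
    (hbc : ∀ j, HasCompactSupport (b j))
    (heq : ∀ g, IsTest n U g → ∫ y, V y * wd n Complex.I l g y
      = ∑ j, ∫ y, Z j y * (wd n (-Complex.I) j g y + b j y * g y))
    {x : Fin n → ℂ} (hx : closedBall x r ⊆ U) :
    wd n Complex.I l (moll n k V) x - ∑ j, (wd n (-Complex.I) j (moll n k (Z j)) x
      - b j x * moll n k (Z j) x) = ∑ j, ∫ y, k (x - y) • ((b j x - b j y) * Z j y) := by
  have h1 := heq _ (hk.isTest hx)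
  have h2 : ∀ c l y, wd n c l (fun y => (k (x - y) : ℂ)) y
      = -wd n c l (fun y => (k y : ℂ)) (x - y) := fun c l y =>
    wd_comp_sub_left (h := fun y => (k y : ℂ))
      ((Complex.ofRealCLM.contDiff.comp hk.smooth).differentiable (by simp) _)
  simp only [h2] at h1
  have hbZ : ∀ j, Integrable fun y => b j y * Z j y := fun j => by
    obtain ⟨C, hC⟩ := (hbc j).exists_bound_of_continuous (hb j)
    exact (hZ j).bdd_mul (c := C) (hb j).aestronglyMeasurable (Filter.Eventually.of_forall hC)
  have h3 : ∀ j, ∫ y, Z j y * (-wd n (-Complex.I) j (fun y => (k y : ℂ)) (x - y)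
      + b j y * (k (x - y) : ℂ)) = -wd n (-Complex.I) j (moll n k (Z j)) x
        + ∫ y, k (x - y) • (b j y * Z j y) := fun j => by
    have ha := hk.wd_moll (c := -Complex.I) (j := j) (hZ j) x
    have hn : Integrable fun y => -(Z j y * wd n (-Complex.I) j (fun y => (k y : ℂ)) (x - y)) :=
      ha.1.neg
    rw [ha.2, ← integral_neg, ← integral_add hn (hk.integrable_smul (hbZ j) x)]
    refine integral_congr_ae (Filter.Eventually.of_forall fun y => ?_)
    simp only [Complex.real_smul]
    ring
  have h4 : ∀ j, ∫ y, k (x - y) • ((b j x - b j y) * Z j y)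
      = b j x * moll n k (Z j) x - ∫ y, k (x - y) • (b j y * Z j y) := fun j => by
    rw [moll, ← integral_const_mul, ← integral_sub ((hk.integrable_smul (hZ j) x).const_mul _)
      (hk.integrable_smul (hbZ j) x)]
    refine integral_congr_ae (Filter.Eventually.of_forall fun y => ?_)
    simp only [Complex.real_smul]
    ring
  simp only [h3] at h1
  simp only [h4]
  rw [(hk.wd_moll hV x).2]
  simp only [mul_neg, integral_neg] at h1
  rw [neg_eq_iff_eq_neg.1 h1, ← Finset.sum_neg_distrib, ← Finset.sum_sub_distrib]
  exact Finset.sum_congr rfl fun j _ => by ring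

lemma eventually_modulus {𝕜 : Type*} [RCLike 𝕜] {g : (Fin n → ℂ) → 𝕜} (hg : Continuous g)
    (hgc : HasCompactSupport g) {δ : ℝ} (hδ : 0 < δ) :
    ∀ᶠ r in nhdsWithin (0 : ℝ) (Ioi 0), ∀ x y, ‖x - y‖ ≤ r → ‖g y - g x‖ ≤ δ := by
  obtain ⟨ε, hε, h⟩ := Metric.uniformContinuous_iff.1
    (hgc.uniformContinuous_of_continuous hg) δ hδ
  filter_upwards [Ioo_mem_nhdsGT hε] with r hr x y hxy
  rw [← dist_eq_norm, dist_comm]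
  refine (h ?_).le
  rw [dist_eq_norm]
  exact hxy.trans_lt hr.2

lemma eventually_forall_closedBall_subset {K U : Set (Fin n → ℂ)} (hK : IsCompact K) (hU : IsOpen U)
    (hKU : K ⊆ U) :
    ∀ᶠ r in nhdsWithin (0 : ℝ) (Ioi 0), ∀ x ∈ K, closedBall x r ⊆ U := by
  obtain ⟨ε, hε, h⟩ := hK.exists_cthickening_subset_open hU hKU
  filter_upwards [Ioo_mem_nhdsGT hε] with r hr x hx
  exact ((closedBall_subset_closedBall hr.2.le).trans (closedBall_subset_cthickening hx ε)).trans h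

end SmoothedEquation

section WeakCaccioppoli

variable {n : ℕ}

lemma normSq_sum_le {ι : Type*} (t : Finset ι) (a : ι → ℂ) :
    Complex.normSq (∑ i ∈ t, a i) ≤ t.card * ∑ i ∈ t, Complex.normSq (a i) := by
  simpa using normSq_sum_mul_le t (fun _ => 1) a

lemma normSq_sub_two_mul_le (a b : ℂ) :
    Complex.normSq (a - 2 * b) ≤ 2 * Complex.normSq a + 8 * Complex.normSq b := by
  have h := Complex.normSq_nonneg (a + 2 * b)
  simp only [Complex.normSq_apply, Complex.sub_re, Complex.sub_im, Complex.add_re, Complex.add_im,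
    Complex.mul_re, Complex.mul_im, Complex.re_ofNat, Complex.im_ofNat] at h ⊢
  nlinarith

/-- Bound on the mollified right-hand side of the Caccioppoli inequality. -/
lemma IsMollifier.sum_normSq_le {k : (Fin n → ℂ) → ℝ} {r δ : ℝ} (hk : IsMollifier n k r)
    {Z : Fin n → Fin n → (Fin n → ℂ) → ℂ} (hZ : ∀ j l, Integrable (Z j l))
    (hZ2 : ∀ j l, Integrable fun y => Complex.normSq (Z j l y))
    {b : Fin n → (Fin n → ℂ) → ℂ} (hb : ∀ j x y, ‖x - y‖ ≤ r → ‖b j x - b j y‖ ≤ δ)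
    (c : ℝ) (d : Fin n → ℂ) {R : Fin n → ℂ} {x : Fin n → ℂ}
    (hR : c ≠ 0 → ∀ l, R l = ∑ j, ∫ y, k (x - y) • ((b j x - b j y) * Z j l y)) :
    ∑ l, Complex.normSq ((c : ℂ) * R l - 2 * ∑ j, d j * moll n k (Z j l) x)
      ≤ (8 * (∑ j, Complex.normSq (d j)) + δ ^ 2 * (2 * n * c ^ 2))
        * moll n k (fun y => ∑ l, ∑ j, Complex.normSq (Z j l y)) x := by
  have hm : moll n k (fun y => ∑ l, ∑ j, Complex.normSq (Z j l y)) x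
      = ∑ l, ∑ j, moll n k (fun y => Complex.normSq (Z j l y)) x := by
    simp only [moll, Finset.smul_sum]
    rw [integral_finsetSum _ fun l _ => integrable_finsetSum _ fun j _ =>
      hk.integrable_smul (hZ2 j l) x]
    exact Finset.sum_congr rfl fun l _ => integral_finsetSum _ fun j _ =>
      hk.integrable_smul (hZ2 j l) x
  rw [hm, Finset.mul_sum]
  refine Finset.sum_le_sum fun l _ => ?_
  have h1 : Complex.normSq (∑ j, d j * moll n k (Z j l) x) ≤ (∑ j, Complex.normSq (d j))
      * ∑ j, moll n k (fun y => Complex.normSq (Z j l y)) x := by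
    refine (normSq_sum_mul_le _ _ _).trans (mul_le_mul_of_nonneg_left
      (Finset.sum_le_sum fun j _ => ?_) (Finset.sum_nonneg fun j _ => Complex.normSq_nonneg _))
    have h := hk.normSq_integral_smul_mul_le (b := fun _ => 1) (δ := 1) (hZ j l) (hZ2 j l) x
      (fun y _ => by simp)
    simpa [moll] using h
  have h2 : Complex.normSq ((c : ℂ) * R l)
      ≤ c ^ 2 * (n * (δ ^ 2 * ∑ j, moll n k (fun y => Complex.normSq (Z j l y)) x)) := by
    by_cases hc : c = 0
    · simp [hc]
    rw [map_mul, Complex.normSq_ofReal, ← sq, hR hc l]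
    refine mul_le_mul_of_nonneg_left ((normSq_sum_le _ _).trans ?_) (sq_nonneg c)
    rw [Finset.card_univ, Fintype.card_fin, Finset.mul_sum (a := δ ^ 2)]
    refine mul_le_mul_of_nonneg_left (Finset.sum_le_sum fun j _ => ?_) (Nat.cast_nonneg n)
    exact hk.normSq_integral_smul_mul_le (hZ j l) (hZ2 j l) x (fun y hy => hb j x y hy)
  refine (normSq_sub_two_mul_le _ _).trans ?_
  linarith

lemma IsTest.contDiff_two {U : Set (Fin n → ℂ)} {g : (Fin n → ℂ) → ℂ} (hg : IsTest n U g) :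
    ContDiff ℝ 2 g := contDiff_infty.1 hg.1 2

/-- One step of the approximation argument in `weak_caccioppoli`. -/
lemma IsMollifier.norm_integral_mul_div_le {k : (Fin n → ℂ) → ℝ} {r δ : ℝ}
    (hk : IsMollifier n k r) {U : Set (Fin n → ℂ)}
    {V : (Fin n → ℂ) → ℂ} {Z : Fin n → Fin n → (Fin n → ℂ) → ℂ} {s χ : (Fin n → ℂ) → ℝ}
    {G : Fin n → (Fin n → ℂ) → ℂ}
    (hV : Integrable V) (hZ : ∀ j l, Integrable (Z j l))
    (hZ2 : ∀ j l, Integrable fun y => Complex.normSq (Z j l y))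
    (hanti : ∀ j l x, Z l j x = -Z j l x) (hs : ContDiff ℝ 2 s)
    (hsc : ∀ j, HasCompactSupport (wd n (-Complex.I) j fun y => (s y : ℂ)))
    (heq : ∀ l g, IsTest n U g → ∫ y, V y * wd n Complex.I l g y
      = ∑ j, ∫ y, Z j l y * (wd n (-Complex.I) j g y
        + wd n (-Complex.I) j (fun y => (s y : ℂ)) y * g y))
    (hχ : ContDiff ℝ 2 χ) (hχc : HasCompactSupport χ)
    (hG : ∀ l, IsTest n U (G l)) (hGχ : ∀ l x, G l x = χ x * G l x)
    (hr1 : ∀ x ∈ tsupport χ, closedBall x r ⊆ U)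
    (hr2 : ∀ j x y, ‖x - y‖ ≤ r → ‖wd n (-Complex.I) j (fun y => (s y : ℂ)) y
      - wd n (-Complex.I) j (fun y => (s y : ℂ)) x‖ ≤ δ)
    (hr3 : ∀ x y, ‖x - y‖ ≤ r → ‖(∑ l, wd n Complex.I l (G l) y)
      - ∑ l, wd n Complex.I l (G l) x‖ ≤ δ)
    {W W' : (Fin n → ℂ) → ℝ}
    (hW : ∀ x, W x = Real.exp (-s x)
      * (8 * ∑ j, Complex.normSq (wd n (-Complex.I) j (fun y => (χ y : ℂ)) x)))
    (hW' : ∀ x, W' x = Real.exp (-s x) * (2 * n * χ x ^ 2))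
    (hWc : Continuous W) (hWs : HasCompactSupport W)
    (hWc' : Continuous W') (hWs' : HasCompactSupport W')
    (hr4 : ∀ x y, ‖x - y‖ ≤ r → ‖W y - W x‖ ≤ δ)
    (hr5 : ∀ x y, ‖x - y‖ ≤ r → ‖W' y - W' x‖ ≤ δ) :
    ‖∫ x, V x * ∑ l, wd n Complex.I l (G l) x‖ ≤ δ * (∫ x, ‖V x‖)
      + √((∫ x, Real.exp (s x) * ∑ l, Complex.normSq (G l x))
        * ((∫ x, (∑ l, ∑ j, Complex.normSq (Z j l x)) * W x)
          + δ * (∫ x, ∑ l, ∑ j, Complex.normSq (Z j l x))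
          + δ ^ 2 * ((∫ x, (∑ l, ∑ j, Complex.normSq (Z j l x)) * W' x)
            + δ * ∫ x, ∑ l, ∑ j, Complex.normSq (Z j l x)))) := by
  set ζ : (Fin n → ℂ) → ℝ := fun x => ∑ l, ∑ j, Complex.normSq (Z j l x) with hζ
  have hζi : Integrable ζ := integrable_finsetSum _ fun l _ => integrable_finsetSum _ fun j _ =>
    hZ2 j l
  have hζ0 : ∀ x, 0 ≤ ζ x := fun x => Finset.sum_nonneg fun l _ => Finset.sum_nonneg fun j _ =>
    Complex.normSq_nonneg _
  have hζn : ∫ x, ‖ζ x‖ = ∫ x, ζ x := by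
    congr 1; funext x; exact Real.norm_of_nonneg (hζ0 x)
  have hχ' : ContDiff ℝ 2 fun x => (χ x : ℂ) := Complex.ofRealCLM.contDiff.comp hχ
  have hs' : ContDiff ℝ 2 fun x => (s x : ℂ) := Complex.ofRealCLM.contDiff.comp hs
  have hbc : ∀ j, Continuous (wd n (-Complex.I) j fun y => (s y : ℂ)) := fun j =>
    (contDiff_wd (m := 1) hs' (by norm_num)).continuous
  have hVr : ContDiff ℝ (⊤ : ℕ∞) (moll n k V) := hk.contDiff_moll hV.locallyIntegrable
  have hVr1 : ContDiff ℝ 1 (moll n k V) := contDiff_infty.1 hVr 1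
  have hZr : ∀ j l, ContDiff ℝ (⊤ : ℕ∞) (moll n k (Z j l)) := fun j l =>
    hk.contDiff_moll (hZ j l).locallyIntegrable
  have hG1 : ∀ l, ContDiff ℝ 1 (G l) := fun l => contDiff_infty.1 (hG l).1 1
  have hdG : ∀ l, Continuous (wd n Complex.I l (G l)) := fun l =>
    (contDiff_wd (m := 0) (hG1 l) (by simp)).continuous
  have hdivc : Continuous fun x => ∑ l, wd n Complex.I l (G l) x :=
    continuous_finsetSum _ fun l _ => hdG l
  have hdivs : HasCompactSupport fun x => ∑ l, wd n Complex.I l (G l) x := by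
    refine HasCompactSupport.intro (isCompact_iUnion fun l => (hG l).2.1) fun x hx => ?_
    refine Finset.sum_eq_zero fun l _ => wd_eq_zero_of_notMem fun h => hx ?_
    exact mem_iUnion.2 ⟨l, h⟩
  obtain ⟨hA, hB, hAB⟩ := caccioppoli_smooth (V := moll n k V) (Z := fun j l => moll n k (Z j l))
    (contDiff_infty.1 hVr 3) (fun j l => contDiff_infty.1 (hZr j l) 1)
    (fun j l x => by simp only [moll, hanti j l, smul_neg, integral_neg]) hs hχ hχc
    (fun l x => rfl)
  -- the mollified right-hand side
  have hP : ∀ x, Real.exp (-s x) * ∑ l, Complex.normSq ((χ x : ℂ)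
      * (wd n Complex.I l (moll n k V) x - ∑ j, (wd n (-Complex.I) j (moll n k (Z j l)) x
        - wd n (-Complex.I) j (fun y => (s y : ℂ)) x * moll n k (Z j l) x))
      - 2 * ∑ j, wd n (-Complex.I) j (fun y => (χ y : ℂ)) x * moll n k (Z j l) x)
      ≤ moll n k ζ x * W x + δ ^ 2 * (moll n k ζ x * W' x) := fun x => by
    have h := hk.sum_normSq_le hZ hZ2 (b := fun j => wd n (-Complex.I) j fun y => (s y : ℂ))
      (δ := δ) (fun j x y hxy => by rw [norm_sub_rev]; exact hr2 j x y hxy) (χ x)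
      (fun j => wd n (-Complex.I) j (fun y => (χ y : ℂ)) x)
      (R := fun l => wd n Complex.I l (moll n k V) x
        - ∑ j, (wd n (-Complex.I) j (moll n k (Z j l)) x
        - wd n (-Complex.I) j (fun y => (s y : ℂ)) x * moll n k (Z j l) x)) (x := x)
      (fun hc l => hk.wd_moll_eq hV (fun j => hZ j l) hbc hsc (heq l)
        (hr1 x (subset_tsupport χ hc)))
    refine (mul_le_mul_of_nonneg_left h (Real.exp_pos _).le).trans (le_of_eq ?_)
    rw [hW, hW']
    ring
  have hζr : Continuous (moll n k ζ) := (hk.contDiff_moll hζi.locallyIntegrable).continuous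
  have hi1 : Integrable fun x => moll n k ζ x * W x :=
    (hζr.mul hWc).integrable_of_hasCompactSupport hWs.mul_left
  have hi2 : Integrable fun x => moll n k ζ x * W' x :=
    (hζr.mul hWc').integrable_of_hasCompactSupport hWs'.mul_left
  have hN := integral_mono hB (hi1.add (hi2.const_mul (δ ^ 2))) hP
  simp only [Pi.add_apply] at hN
  rw [integral_add hi1 (hi2.const_mul (δ ^ 2)), integral_const_mul] at hN
  have e1 := (abs_le.1 (hk.norm_integral_moll_mul_sub_le hζi hWc hWs hr4)).2
  have e2 := (abs_le.1 (hk.norm_integral_moll_mul_sub_le hζi hWc' hWs' hr5)).2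
  rw [hζn] at e1 e2
  -- integration by parts
  have hT : ∀ l, Continuous (wd n Complex.I l (moll n k V)) := fun l =>
    (contDiff_wd (m := 0) hVr1 (by simp)).continuous
  have hGc : ∀ l, Continuous (G l) := fun l => (hG l).1.continuous
  have hibp : ∫ x, moll n k V x * ∑ l, wd n Complex.I l (G l) x
      = ∫ x, -∑ l, wd n Complex.I l (moll n k V) x * G l x := by
    simp only [Finset.mul_sum]
    rw [integral_neg, integral_finsetSum _ fun l _ => ?_, integral_finsetSum _ fun l _ => ?_,
      ← Finset.sum_neg_distrib]
    · exact Finset.sum_congr rfl fun l _ => integral_mul_wd hVr1 (hG1 l) (hG l).2.1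
    · exact ((hT l).mul (hGc l)).integrable_of_hasCompactSupport (hG l).2.1.mul_left
    · exact (hVr1.continuous.mul (hdG l)).integrable_of_hasCompactSupport
        (HasCompactSupport.wd (hG l).2.1).mul_left
  have hGs : HasCompactSupport fun x => Real.exp (s x) * ∑ l, Complex.normSq (G l x) := by
    refine HasCompactSupport.intro (isCompact_iUnion fun l => (hG l).2.1) fun x hx => ?_
    rw [Finset.sum_eq_zero fun l _ => ?_, mul_zero]
    rw [image_eq_zero_of_notMem_tsupport fun h => hx (mem_iUnion.2 ⟨l, h⟩), map_zero]
  have hcs : Complex.normSq (∫ x, moll n k V x * ∑ l, wd n Complex.I l (G l) x)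
      ≤ (∫ x, Real.exp (s x) * ∑ l, Complex.normSq (G l x)) * ∫ x, χ x ^ 2 * Real.exp (-s x)
        * ∑ l, Complex.normSq (wd n Complex.I l (moll n k V) x) := by
    rw [hibp]
    refine normSq_integral_le ?_ hA ?_ ?_ ?_ fun x => ?_
    · refine (Continuous.mul (Real.continuous_exp.comp hs.continuous)
        (continuous_finsetSum _ fun l _ => Complex.continuous_normSq.comp (hGc l))
        ).integrable_of_hasCompactSupport hGs
    · refine Integrable.neg (integrable_finsetSum _ fun l _ => ?_)
      exact ((hT l).mul (hGc l)).integrable_of_hasCompactSupport (hG l).2.1.mul_left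
    · exact fun x => mul_nonneg (Real.exp_pos _).le (Finset.sum_nonneg fun l _ =>
        Complex.normSq_nonneg _)
    · exact fun x => mul_nonneg (mul_nonneg (sq_nonneg _) (Real.exp_pos _).le)
        (Finset.sum_nonneg fun l _ => Complex.normSq_nonneg _)
    · have h1 : ∑ l, wd n Complex.I l (moll n k V) x * G l x
          = (χ x : ℂ) * ∑ l, wd n Complex.I l (moll n k V) x * G l x := by
        rw [Finset.mul_sum]
        refine Finset.sum_congr rfl fun l _ => ?_
        conv_lhs => rw [hGχ l x]
        ring
      rw [Complex.normSq_neg, h1, map_mul, Complex.normSq_ofReal]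
      have h2 := normSq_sum_mul_le Finset.univ
        (fun l => wd n Complex.I l (moll n k V) x) (fun l => G l x)
      have h3 : Real.exp (s x) * Real.exp (-s x) = 1 := by rw [← Real.exp_add]; simp
      calc _ ≤ χ x * χ x * ((∑ l, Complex.normSq (wd n Complex.I l (moll n k V) x))
            * ∑ l, Complex.normSq (G l x)) :=
            mul_le_mul_of_nonneg_left h2 (mul_self_nonneg _)
        _ = (Real.exp (s x) * Real.exp (-s x)) * (χ x * χ x
            * ((∑ l, Complex.normSq (wd n Complex.I l (moll n k V) x))
            * ∑ l, Complex.normSq (G l x))) := by rw [h3, one_mul]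
        _ = _ := by ring
  have hfin : ‖∫ x, moll n k V x * ∑ l, wd n Complex.I l (G l) x‖
      ≤ √((∫ x, Real.exp (s x) * ∑ l, Complex.normSq (G l x))
        * ((∫ x, ζ x * W x) + δ * (∫ x, ζ x)
          + δ ^ 2 * ((∫ x, ζ x * W' x) + δ * ∫ x, ζ x))) := by
    refine Real.le_sqrt_of_sq_le ?_
    rw [← Complex.normSq_eq_norm_sq]
    refine hcs.trans (mul_le_mul_of_nonneg_left ?_ (integral_nonneg fun x =>
      mul_nonneg (Real.exp_pos _).le (Finset.sum_nonneg fun l _ => Complex.normSq_nonneg _)))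
    refine hAB.trans (hN.trans ?_)
    have := mul_le_mul_of_nonneg_left e2 (sq_nonneg δ)
    linarith
  have hlast := hk.norm_integral_moll_mul_sub_le hV hdivc hdivs hr3
  calc _ = ‖(∫ x, moll n k V x * ∑ l, wd n Complex.I l (G l) x)
        - ((∫ x, moll n k V x * ∑ l, wd n Complex.I l (G l) x)
          - ∫ x, V x * ∑ l, wd n Complex.I l (G l) x)‖ := by rw [sub_sub_cancel]
    _ ≤ _ := (norm_sub_le _ _).trans (by linarith)

/-- A Caccioppoli inequality for a weak solution of
`∂V/∂z̄_l = ∑_j (∂/∂z_j - ∂s/∂z_j) Z_{jl}` with antisymmetric `Z`, tested on forms supported where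
the cut-off `χ` equals one. -/
lemma weak_caccioppoli {U : Set (Fin n → ℂ)} (hU : IsOpen U)
    {V : (Fin n → ℂ) → ℂ} {Z : Fin n → Fin n → (Fin n → ℂ) → ℂ} {s χ : (Fin n → ℂ) → ℝ}
    {G : Fin n → (Fin n → ℂ) → ℂ}
    (hV : Integrable V) (hZ : ∀ j l, Integrable (Z j l))
    (hZ2 : ∀ j l, Integrable fun y => Complex.normSq (Z j l y))
    (hanti : ∀ j l x, Z l j x = -Z j l x) (hs : ContDiff ℝ 2 s)
    (hsc : ∀ j, HasCompactSupport (wd n (-Complex.I) j fun y => (s y : ℂ)))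
    (heq : ∀ l g, IsTest n U g → ∫ y, V y * wd n Complex.I l g y
      = ∑ j, ∫ y, Z j l y * (wd n (-Complex.I) j g y
        + wd n (-Complex.I) j (fun y => (s y : ℂ)) y * g y))
    (hχ : ContDiff ℝ 2 χ) (hχc : HasCompactSupport χ) (hχU : tsupport χ ⊆ U)
    (hG : ∀ l, IsTest n U (G l)) (hGχ : ∀ l x, G l x = χ x * G l x) :
    Complex.normSq (∫ x, V x * ∑ l, wd n Complex.I l (G l) x)
      ≤ (∫ x, Real.exp (s x) * ∑ l, Complex.normSq (G l x))
        * ∫ x, (∑ l, ∑ j, Complex.normSq (Z j l x)) * (Real.exp (-s x)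
          * (8 * ∑ j, Complex.normSq (wd n (-Complex.I) j (fun y => (χ y : ℂ)) x))) := by
  have hχ' : ContDiff ℝ 2 fun x => (χ x : ℂ) := Complex.ofRealCLM.contDiff.comp hχ
  have hs' : ContDiff ℝ 2 fun x => (s x : ℂ) := Complex.ofRealCLM.contDiff.comp hs
  have hbc : ∀ j, Continuous (wd n (-Complex.I) j fun y => (s y : ℂ)) := fun j =>
    (contDiff_wd (m := 1) hs' (by norm_num)).continuous
  have hes : Continuous fun x => Real.exp (-s x) := Real.continuous_exp.comp hs.continuous.neg
  have hχs : HasCompactSupport fun x => (χ x : ℂ) := hχc.comp_left (g := Complex.ofReal) (by simp)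
  have hG1 : ∀ l, ContDiff ℝ 1 (G l) := fun l => contDiff_infty.1 (hG l).1 1
  have hdivc : Continuous fun x => ∑ l, wd n Complex.I l (G l) x :=
    continuous_finsetSum _ fun l _ => (contDiff_wd (m := 0) (hG1 l) (by simp)).continuous
  have hdivs : HasCompactSupport fun x => ∑ l, wd n Complex.I l (G l) x := by
    refine HasCompactSupport.intro (isCompact_iUnion fun l => (hG l).2.1) fun x hx => ?_
    refine Finset.sum_eq_zero fun l _ => wd_eq_zero_of_notMem fun h => hx ?_
    exact mem_iUnion.2 ⟨l, h⟩
  set W : (Fin n → ℂ) → ℝ := fun x => Real.exp (-s x)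
      * (8 * ∑ j, Complex.normSq (wd n (-Complex.I) j (fun y => (χ y : ℂ)) x)) with hW
  set W' : (Fin n → ℂ) → ℝ := fun x => Real.exp (-s x) * (2 * n * χ x ^ 2) with hW'
  have hWc : Continuous W := hes.mul (continuous_const.mul (continuous_finsetSum _ fun j _ =>
    Complex.continuous_normSq.comp (contDiff_wd (m := 1) hχ' (by norm_num)).continuous))
  have hWs : HasCompactSupport W := by
    refine HasCompactSupport.intro hχs.isCompact fun x hx => ?_
    simp [hW, wd_eq_zero_of_notMem hx]
  have hWc' : Continuous W' := hes.mul (continuous_const.mul (hχ.continuous.pow 2))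
  have hWs' : HasCompactSupport W' := by
    refine HasCompactSupport.intro hχc.isCompact fun x hx => ?_
    simp [hW', image_eq_zero_of_notMem_tsupport hx]
  set ζ : (Fin n → ℂ) → ℝ := fun x => ∑ l, ∑ j, Complex.normSq (Z j l x) with hζ
  have key : ∀ δ : ℝ, 0 < δ → ‖∫ x, V x * ∑ l, wd n Complex.I l (G l) x‖ ≤ δ * (∫ x, ‖V x‖)
      + √((∫ x, Real.exp (s x) * ∑ l, Complex.normSq (G l x))
        * ((∫ x, ζ x * W x) + δ * (∫ x, ζ x)
          + δ ^ 2 * ((∫ x, ζ x * W' x) + δ * ∫ x, ζ x))) := by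
    intro δ hδ
    have h2 := Filter.eventually_all.2 fun j => eventually_modulus (hbc j) (hsc j) hδ
    obtain ⟨r, hr1, hr2, hr3, hr4, hr5, hr⟩ :=
      ((eventually_forall_closedBall_subset hχc.isCompact hU hχU).and (h2.and
        ((eventually_modulus hdivc hdivs hδ).and ((eventually_modulus hWc hWs hδ).and
        ((eventually_modulus hWc' hWs' hδ).and self_mem_nhdsWithin))))).exists
    obtain ⟨k, hk⟩ := exists_isMollifier n hr
    exact hk.norm_integral_mul_div_le hV hZ hZ2 hanti hs hsc heq hχ hχc hG hGχ hr1 hr2 hr3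
      (fun _ => rfl) (fun _ => rfl) hWc hWs hWc' hWs' hr4 hr5
  have hlim : Filter.Tendsto (fun δ : ℝ => δ * (∫ x, ‖V x‖)
      + √((∫ x, Real.exp (s x) * ∑ l, Complex.normSq (G l x))
        * ((∫ x, ζ x * W x) + δ * (∫ x, ζ x)
          + δ ^ 2 * ((∫ x, ζ x * W' x) + δ * ∫ x, ζ x)))) (nhdsWithin 0 (Ioi 0))
      (nhds (0 * (∫ x, ‖V x‖)
      + √((∫ x, Real.exp (s x) * ∑ l, Complex.normSq (G l x))
        * ((∫ x, ζ x * W x) + 0 * (∫ x, ζ x)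
          + 0 ^ 2 * ((∫ x, ζ x * W' x) + 0 * ∫ x, ζ x))))) :=
    Filter.Tendsto.mono_left (Continuous.tendsto (by fun_prop) 0) nhdsWithin_le_nhds
  have h := ge_of_tendsto hlim (Filter.eventually_of_mem self_mem_nhdsWithin key)
  simp only [zero_mul, zero_add, add_zero, zero_pow two_ne_zero] at h
  rw [Complex.normSq_eq_norm_sq]
  have h0 : 0 ≤ (∫ x, Real.exp (s x) * ∑ l, Complex.normSq (G l x)) * ∫ x, ζ x * W x :=
    mul_nonneg (integral_nonneg fun x => mul_nonneg (Real.exp_pos _).le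
      (Finset.sum_nonneg fun l _ => Complex.normSq_nonneg _))
      (integral_nonneg fun x => mul_nonneg (Finset.sum_nonneg fun l _ => Finset.sum_nonneg
        fun j _ => Complex.normSq_nonneg _) (mul_nonneg (Real.exp_pos _).le (mul_nonneg
        (by norm_num) (Finset.sum_nonneg fun j _ => Complex.normSq_nonneg _))))
  calc _ ≤ √((∫ x, Real.exp (s x) * ∑ l, Complex.normSq (G l x)) * ∫ x, ζ x * W x) ^ 2 := by
        gcongr
    _ = _ := Real.sq_sqrt h0

end WeakCaccioppoli

section TestForms

variable {n : ℕ} {U : Set (Fin n → ℂ)}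

lemma MeasureTheory.MemLp.integrable_normSq {Y : Type*} [MeasurableSpace Y] {μ : Measure Y}
    {f : Y → ℂ} (hf : MemLp f 2 μ) : Integrable (fun y => Complex.normSq (f y)) μ := by
  simp only [Complex.normSq_eq_norm_sq]
  exact hf.integrable_norm_pow two_ne_zero

lemma isTest_zero : IsTest n U fun _ => 0 :=
  ⟨contDiff_const, HasCompactSupport.zero, by simp [tsupport]⟩

lemma IsTest.add {g h : (Fin n → ℂ) → ℂ} (hg : IsTest n U g) (hh : IsTest n U h) :
    IsTest n U fun x => g x + h x :=
  ⟨hg.1.add hh.1, hg.2.1.add hh.2.1,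
    (tsupport_add g h).trans (union_subset hg.2.2 hh.2.2)⟩

lemma IsTest.const_mul {g : (Fin n → ℂ) → ℂ} (hg : IsTest n U g) (a : ℂ) :
    IsTest n U fun x => a * g x :=
  ⟨contDiff_const.mul hg.1, hg.2.1.mul_left,
    (closure_mono (Function.support_mul_subset_right _ g)).trans hg.2.2⟩

/-- Tuples of test functions on `U`, as a complex vector space. -/
def testForms (n : ℕ) (U : Set (Fin n → ℂ)) : Submodule ℂ (Fin n → (Fin n → ℂ) → ℂ) where
  carrier := {G | ∀ j, IsTest n U (G j)}
  add_mem' := fun {_ _} hG hH j => (hG j).add (hH j)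
  zero_mem' := fun _ => isTest_zero
  smul_mem' := fun a _ hG j => (hG j).const_mul a

lemma differentiableAt_testForms (G : testForms n U) (j : Fin n) (x : Fin n → ℂ) :
    DifferentiableAt ℝ (G.1 j) x :=
  ((G.2 j).1.differentiable (by simp)) x

/-- The divergence `∑_j ∂G_j/∂z̄_j`. -/
def divForm (n : ℕ) (G : Fin n → (Fin n → ℂ) → ℂ) (x : Fin n → ℂ) : ℂ :=
  ∑ j, wd n Complex.I j (G j) x

/-- The divergence as a linear map on test forms. -/
def divLin (n : ℕ) (U : Set (Fin n → ℂ)) : testForms n U →ₗ[ℂ] ((Fin n → ℂ) → ℂ) where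
  toFun G := divForm n G.1
  map_add' G H := by
    funext x
    simp only [divForm, Pi.add_apply, ← Finset.sum_add_distrib]
    exact Finset.sum_congr rfl fun j _ =>
      wd_add (differentiableAt_testForms G j x) (differentiableAt_testForms H j x)
  map_smul' a G := by
    funext x
    simp only [divForm, Pi.smul_apply, smul_eq_mul, Finset.mul_sum, RingHom.id_apply]
    exact Finset.sum_congr rfl fun j _ => wd_const_mul a (differentiableAt_testForms G j x)

/-- The components of `∂(e^s G)` as linear maps on test forms. -/
def curlLin (n : ℕ) (U : Set (Fin n → ℂ)) (s : (Fin n → ℂ) → ℝ) (hs : ContDiff ℝ 2 s)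
    (j k : Fin n) : testForms n U →ₗ[ℂ] ((Fin n → ℂ) → ℂ) where
  toFun G x := wd n (-Complex.I) j (fun y => (Real.exp (s y) : ℂ) * G.1 k y) x
    - wd n (-Complex.I) k (fun y => (Real.exp (s y) : ℂ) * G.1 j y) x
  map_add' G H := by
    have he : Differentiable ℝ fun y => (Real.exp (s y) : ℂ) :=
      (Complex.ofRealCLM.contDiff.comp hs.exp).differentiable (by norm_num)
    have hd : ∀ (F : testForms n U) m x,
        DifferentiableAt ℝ (fun y => (Real.exp (s y) : ℂ) * F.1 m y) x := fun F m x =>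
      (he x).mul (differentiableAt_testForms F m x)
    have h : ∀ i m x, wd n (-Complex.I) i (fun y => (Real.exp (s y) : ℂ) * (G + H).1 m y) x
        = wd n (-Complex.I) i (fun y => (Real.exp (s y) : ℂ) * G.1 m y) x
          + wd n (-Complex.I) i (fun y => (Real.exp (s y) : ℂ) * H.1 m y) x := fun i m x => by
      rw [← wd_add (hd G m x) (hd H m x)]
      congr 1
      funext y
      exact mul_add _ _ _
    funext x
    simp only [Pi.add_apply, h]
    ring
  map_smul' a G := by
    have he : Differentiable ℝ fun y => (Real.exp (s y) : ℂ) :=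
      (Complex.ofRealCLM.contDiff.comp hs.exp).differentiable (by norm_num)
    have hd : ∀ (F : testForms n U) m x,
        DifferentiableAt ℝ (fun y => (Real.exp (s y) : ℂ) * F.1 m y) x := fun F m x =>
      (he x).mul (differentiableAt_testForms F m x)
    have h : ∀ i m x, wd n (-Complex.I) i (fun y => (Real.exp (s y) : ℂ) * (a • G).1 m y) x
        = a * wd n (-Complex.I) i (fun y => (Real.exp (s y) : ℂ) * G.1 m y) x := fun i m x => by
      rw [← wd_const_mul a (hd G m x)]
      congr 1
      funext y
      exact mul_left_comm _ _ _
    funext x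
    simp only [Pi.smul_apply, smul_eq_mul, RingHom.id_apply, h]
    ring

lemma memLp_test {g : (Fin n → ℂ) → ℂ} (hg : IsTest n U g) (μ : Measure (Fin n → ℂ))
    [IsFiniteMeasureOnCompacts μ] : MemLp g 2 μ :=
  hg.1.continuous.memLp_of_hasCompactSupport hg.2.1

/-- The functional `G ↦ ∑_j ∫ A_j G_j` on test forms. -/
def pairLin (n : ℕ) (U : Set (Fin n → ℂ)) (A : Fin n → (Fin n → ℂ) → ℂ)
    (hA : ∀ j, MemLp (A j) 2 volume) : testForms n U →ₗ[ℂ] ℂ where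
  toFun G := ∑ j, ∫ x, A j x * G.1 j x
  map_add' G H := by
    rw [← Finset.sum_add_distrib]
    refine Finset.sum_congr rfl fun j _ => ?_
    have h1 : Integrable fun x => A j x * G.1 j x := (hA j).integrable_mul (memLp_test (G.2 j) _)
    have h2 : Integrable fun x => A j x * H.1 j x := (hA j).integrable_mul (memLp_test (H.2 j) _)
    rw [← integral_add h1 h2]
    exact integral_congr_ae (Filter.Eventually.of_forall fun x => mul_add _ _ _)
  map_smul' a G := by
    rw [RingHom.id_apply, smul_eq_mul, Finset.mul_sum]
    refine Finset.sum_congr rfl fun j _ => ?_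
    rw [← integral_const_mul]
    exact integral_congr_ae (Filter.Eventually.of_forall fun x => mul_left_comm _ _ _)

lemma norm_pairLin_sq_le (A : Fin n → (Fin n → ℂ) → ℂ) (hA : ∀ j, MemLp (A j) 2 volume)
    (G : testForms n U) : ‖pairLin n U A hA G‖ ^ 2
      ≤ (∑ j, ∫ x, Complex.normSq (A j x)) * ∫ x, ∑ j, Complex.normSq (G.1 j x) := by
  have h1 : ∀ j, Integrable fun x => A j x * G.1 j x := fun j =>
    (hA j).integrable_mul (memLp_test (G.2 j) _)
  have h2 : pairLin n U A hA G = ∫ x, ∑ j, A j x * G.1 j x :=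
    (integral_finsetSum Finset.univ fun j _ => h1 j).symm
  rw [h2, ← Complex.normSq_eq_norm_sq, ← integral_finsetSum _ fun j _ => (hA j).integrable_normSq]
  exact normSq_integral_le (integrable_finsetSum _ fun j _ => (hA j).integrable_normSq)
    (integrable_finsetSum _ fun j _ => (memLp_test (G.2 j) volume).integrable_normSq)
    (integrable_finsetSum _ fun j _ => h1 j)
    (fun x => Finset.sum_nonneg fun j _ => Complex.normSq_nonneg _)
    (fun x => Finset.sum_nonneg fun j _ => Complex.normSq_nonneg _)
    (fun x => normSq_sum_mul_le _ _ _)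

lemma isTest_single {g : (Fin n → ℂ) → ℂ} (hg : IsTest n U g) (l j : Fin n) :
    IsTest n U (Pi.single (M := fun _ => (Fin n → ℂ) → ℂ) l g j) := by
  by_cases h : j = l
  · subst h; simpa using hg
  · rw [Pi.single_eq_of_ne h]; exact isTest_zero

lemma divForm_single {g : (Fin n → ℂ) → ℂ} (l : Fin n) :
    divForm n (Pi.single l g) = wd n Complex.I l g := by
  funext x
  rw [divForm, Finset.sum_eq_single l]
  · simp
  · intro j _ hj
    rw [Pi.single_eq_of_ne hj]
    exact wd_const 0
  · simp

lemma continuous_divForm (G : testForms n U) : Continuous (divForm n G.1) :=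
  continuous_finsetSum _ fun j _ =>
    (contDiff_wd (m := 0) (contDiff_infty.1 (G.2 j).1 1) (by simp)).continuous

lemma hasCompactSupport_divForm (G : testForms n U) : HasCompactSupport (divForm n G.1) := by
  refine HasCompactSupport.intro (isCompact_iUnion fun l => (G.2 l).2.1) fun x hx => ?_
  refine Finset.sum_eq_zero fun l _ => wd_eq_zero_of_notMem fun h => hx ?_
  exact mem_iUnion.2 ⟨l, h⟩

end TestForms

section TwistedRepresentation

variable {n : ℕ} {U : Set (Fin n → ℂ)}

lemma memLp_indicator_mul (hUb : Bornology.IsBounded U) (hUm : MeasurableSet U)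
    {b w : (Fin n → ℂ) → ℂ} (hb : Continuous b) (hw : MemLp w 2 volume) :
    MemLp (U.indicator fun x => b x * w x) 2 volume := by
  obtain ⟨C, hC⟩ := hUb.isCompact_closure.exists_bound_of_continuousOn hb.continuousOn
  refine hw.of_le_mul (c := |C|)
    ((hb.aestronglyMeasurable.mul hw.aestronglyMeasurable).indicator hUm)
    (Filter.Eventually.of_forall fun x => ?_)
  by_cases hx : x ∈ U
  · rw [indicator_of_mem hx, norm_mul]
    exact mul_le_mul_of_nonneg_right ((hC x (subset_closure hx)).trans (le_abs_self C))
      (norm_nonneg _)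
  · rw [indicator_of_notMem hx, norm_zero]
    positivity

lemma MeasureTheory.MemLp.integrable_indicator_of_isBounded (hUb : Bornology.IsBounded U)
    (hUm : MeasurableSet U) {f : (Fin n → ℂ) → ℂ} (hf : MemLp (U.indicator f) 2 volume) :
    Integrable (U.indicator f) := by
  have h : IntegrableOn (U.indicator f) U := by
    have : IsFiniteMeasure (volume.restrict U) := ⟨by
      rw [Measure.restrict_apply_univ]; exact hUb.measure_lt_top⟩
    exact hf.restrict U |>.integrable (by norm_num)
  rw [← integrable_indicator_iff hUm] at h
  simpa only [indicator_indicator, inter_self] using h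

lemma wd_mul_single {g h : (Fin n → ℂ) → ℂ} {c : ℂ} (l j k : Fin n) (x : Fin n → ℂ) :
    wd n c j (fun y => h y * Pi.single (M := fun _ => (Fin n → ℂ) → ℂ) l g k y) x
      = if k = l then wd n c j (fun y => h y * g y) x else 0 := by
  split_ifs with hkl
  · subst hkl; simp
  · simp only [Pi.single_eq_of_ne hkl, Pi.zero_apply, mul_zero]
    exact wd_const 0

/-- Duality: an a priori estimate for the twisted complex yields a representation of the functional
`G ↦ ∑_j ∫ A_j G_j` through a weak solution of the twisted system. -/
lemma exists_twisted_representation (hUb : Bornology.IsBounded U) (hUm : MeasurableSet U)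
    {A : Fin n → (Fin n → ℂ) → ℂ} {u : (Fin n → ℂ) → ℂ} (hA : ∀ j, MemLp (A j) 2 volume)
    (hu : MemLp u 2 volume)
    (hAu : ∀ l g, IsTest n U g → ∫ x, A l x * g x = -∫ x, u x * wd n Complex.I l g x)
    {s φ a : (Fin n → ℂ) → ℝ} (hs : ContDiff ℝ 2 s) (hφ : Continuous φ) (ha : Continuous a)
    (ha0 : ∀ x, 0 ≤ a x) {C : ℝ} (hC : 0 ≤ C)
    (hest : ∀ G : testForms n U, ∫ x, ∑ j, Complex.normSq (G.1 j x)
      ≤ C * ∫ x, ((1 / 2) * (∑ j, ∑ k, Complex.normSq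
          (wd n (-Complex.I) j (fun y => (Real.exp (s y) : ℂ) * G.1 k y) x
            - wd n (-Complex.I) k (fun y => (Real.exp (s y) : ℂ) * G.1 j y) x))
          * Real.exp (-φ x) + 3 * a x * Complex.normSq (divForm n G.1 x))) :
    ∃ (V w₀ : (Fin n → ℂ) → ℂ) (Z : Fin n → Fin n → (Fin n → ℂ) → ℂ) (ω : (Fin n → ℂ) → ℝ),
      Integrable V ∧ (∀ j l, Integrable (Z j l)) ∧
      (∀ j l, Integrable fun x => Complex.normSq (Z j l x)) ∧
      (∀ j l x, Z l j x = -Z j l x) ∧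
      (∀ l g, IsTest n U g → ∫ y, V y * wd n Complex.I l g y
        = ∑ j, ∫ y, Z j l y * (wd n (-Complex.I) j g y
          + wd n (-Complex.I) j (fun y => (s y : ℂ)) y * g y)) ∧
      Integrable ω ∧ (∀ x, 0 ≤ ω x) ∧ ∫ x, ω x ≤ C * ∑ j, ∫ x, Complex.normSq (A j x) ∧
      MemLp w₀ 2 volume ∧ (∀ x, Complex.normSq (w₀ x) ≤ ω x) ∧
      (∀ x, ∑ l, ∑ j, Complex.normSq (Z j l x) ≤ 2 * Real.exp (2 * s x - φ x) * ω x) ∧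
      ∀ G : testForms n U, pairLin n U A hA G = (∫ x, V x * divForm n G.1 x)
        + ∫ x, w₀ x * ((√(3 * a x) : ℂ) * divForm n G.1 x) := by
  have hes : ContDiff ℝ 2 fun y => (Real.exp (s y) : ℂ) :=
    Complex.ofRealCLM.contDiff.comp hs.exp
  have hs' : Differentiable ℝ fun x => (s x : ℂ) :=
    (Complex.ofRealCLM.contDiff.comp hs).differentiable (by norm_num)
  set b : (Fin n → ℂ) → ℂ := fun x => (√(3 * a x) : ℂ) with hb
  set c : (Fin n → ℂ) → ℂ := fun x => (√(Real.exp (-φ x) / 2) : ℂ) with hc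
  have hbc : Continuous b := Complex.continuous_ofReal.comp
    (Real.continuous_sqrt.comp (continuous_const.mul ha))
  have hcc : Continuous c := Complex.continuous_ofReal.comp
    (Real.continuous_sqrt.comp ((Real.continuous_exp.comp hφ.neg).div_const 2))
  have hbn : ∀ x, Complex.normSq (b x) = 3 * a x := fun x => by
    rw [hb, Complex.normSq_ofReal, Real.mul_self_sqrt (by have := ha0 x; linarith)]
  have hcn : ∀ x, Complex.normSq (c x) = Real.exp (-φ x) / 2 := fun x => by
    rw [hc, Complex.normSq_ofReal, Real.mul_self_sqrt (by positivity)]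
  let J : Option (Fin n × Fin n) → testForms n U →ₗ[ℂ] ((Fin n → ℂ) → ℂ) := fun i =>
    match i with
    | none => LinearMap.mulLeft ℂ b ∘ₗ divLin n U
    | some p => LinearMap.mulLeft ℂ c ∘ₗ curlLin n U s hs p.1 p.2
  have hJ0 : ∀ G x, J none G x = b x * divForm n G.1 x := fun _ _ => rfl
  have hJ1 : ∀ p G x, J (some p) G x
      = c x * (wd n (-Complex.I) p.1 (fun y => (Real.exp (s y) : ℂ) * G.1 p.2 y) x
        - wd n (-Complex.I) p.2 (fun y => (Real.exp (s y) : ℂ) * G.1 p.1 y) x) := fun _ _ _ => rfl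
  have hJ : ∀ i G, MemLp (J i G) 2 volume := by
    intro i G
    have hγ : ∀ k, ContDiff ℝ 2 fun y => (Real.exp (s y) : ℂ) * G.1 k y := fun k =>
      hes.mul (G.2 k).contDiff_two
    have hγc : ∀ k, HasCompactSupport fun y => (Real.exp (s y) : ℂ) * G.1 k y := fun k =>
      (G.2 k).2.1.mul_left
    rcases i with _ | p
    · exact (hbc.mul (continuous_divForm G)).memLp_of_hasCompactSupport
        (hasCompactSupport_divForm G).mul_left
    · refine Continuous.memLp_of_hasCompactSupport (hcc.mul (Continuous.sub
        (contDiff_wd (m := 1) (hγ _) (by norm_num)).continuous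
        (contDiff_wd (m := 1) (hγ _) (by norm_num)).continuous)) ?_
      exact ((HasCompactSupport.wd (hγc _)).sub (HasCompactSupport.wd (hγc _))).mul_left
  set M := ∑ j, ∫ x, Complex.normSq (A j x) with hM
  have hM0 : 0 ≤ M := Finset.sum_nonneg fun j _ => integral_nonneg fun x => Complex.normSq_nonneg _
  have hsum : ∀ G, ∑ i, ∫ y, Complex.normSq (J i G y)
      = ∫ x, ((1 / 2) * (∑ j, ∑ k, Complex.normSq
          (wd n (-Complex.I) j (fun y => (Real.exp (s y) : ℂ) * G.1 k y) x
            - wd n (-Complex.I) k (fun y => (Real.exp (s y) : ℂ) * G.1 j y) x))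
          * Real.exp (-φ x) + 3 * a x * Complex.normSq (divForm n G.1 x)) := fun G => by
    rw [← integral_finsetSum _ fun i _ => (hJ i G).integrable_normSq]
    refine integral_congr_ae (Filter.Eventually.of_forall fun x => ?_)
    simp only [Fintype.sum_option, Fintype.sum_prod_type, hJ0, hJ1, Complex.normSq_mul, hbn, hcn,
      ← Finset.mul_sum]
    ring
  obtain ⟨w, hw, hwC, hwl⟩ := exists_memLp_repr J hJ (pairLin n U A hA) (C := √(C * M))
    (Real.sqrt_nonneg _) fun G => by
      rw [Real.sq_sqrt (mul_nonneg hC hM0), hsum, mul_comm C M, mul_assoc]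
      exact (norm_pairLin_sq_le A hA G).trans (mul_le_mul_of_nonneg_left (hest G) hM0)
  rw [Real.sq_sqrt (mul_nonneg hC hM0)] at hwC
  have hV : MemLp (U.indicator fun x => -u x - b x * w none x) 2 volume := by
    have h1 := memLp_indicator_mul hUb hUm continuous_const (b := fun _ => (-1 : ℂ)) hu
    have h2 := memLp_indicator_mul hUb hUm hbc (hw none)
    convert h1.sub h2 using 1
    funext x
    by_cases hx : x ∈ U <;> simp [hx]
  have hZ : ∀ j l, MemLp (U.indicator fun x => (c x * (Real.exp (s x) : ℂ))
      * (w (some (j, l)) x - w (some (l, j)) x)) 2 volume := fun j l =>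
    memLp_indicator_mul hUb hUm (hcc.mul hes.continuous)
      ((hw (some (j, l))).sub (hw (some (l, j))))
  have hdU : ∀ (G : testForms n U) x, x ∉ U → divForm n G.1 x = 0 := fun G x hx =>
    Finset.sum_eq_zero fun j _ => wd_eq_zero_of_notMem fun h => hx ((G.2 j).2.2 h)
  have hAu' : ∀ G, pairLin n U A hA G = -∫ x, u x * divForm n G.1 x := fun G => by
    have h1 : ∀ j, ∫ x, A j x * G.1 j x = -∫ x, u x * wd n Complex.I j (G.1 j) x := fun j =>
      hAu j _ (G.2 j)
    have h2 : ∀ j, Integrable fun x => u x * wd n Complex.I j (G.1 j) x := fun j =>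
      hu.integrable_mul (q := 2) (Continuous.memLp_of_hasCompactSupport
        (contDiff_wd (m := 0) (contDiff_infty.1 (G.2 j).1 1) (by simp)).continuous
        (HasCompactSupport.wd (G.2 j).2.1))
    change ∑ j, ∫ x, A j x * G.1 j x = _
    simp only [h1, divForm, Finset.mul_sum, Finset.sum_neg_distrib]
    rw [integral_finsetSum _ fun j _ => h2 j]
  have hVG : ∀ G : testForms n U, ∫ x, (U.indicator (fun x => -u x - b x * w none x) x)
      * divForm n G.1 x = pairLin n U A hA G - ∫ x, w none x * (b x * divForm n G.1 x) :=
    fun G => by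
    have hd2 : MemLp (divForm n G.1) 2 volume :=
      (continuous_divForm G).memLp_of_hasCompactSupport (hasCompactSupport_divForm G)
    have i1 : Integrable fun x => u x * divForm n G.1 x := hu.integrable_mul hd2
    have i2 : Integrable fun x => w none x * (b x * divForm n G.1 x) :=
      (hw none).integrable_mul (hJ none G)
    have i3 : Integrable fun x => -(u x * divForm n G.1 x) := i1.neg
    rw [hAu', ← integral_neg, ← integral_sub i3 i2]
    refine integral_congr_ae (Filter.Eventually.of_forall fun x => ?_)
    simp only
    by_cases hx : x ∈ U
    · rw [indicator_of_mem hx]; ring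
    · rw [hdU G x hx]; ring
  refine ⟨_, w none, fun j l => _, fun x => ∑ i, Complex.normSq (w i x),
    hV.integrable_indicator_of_isBounded hUb hUm,
    fun j l => (hZ j l).integrable_indicator_of_isBounded hUb hUm,
    fun j l => (hZ j l).integrable_normSq, fun j l x => ?_, fun l g hg => ?_,
    integrable_finsetSum _ fun i _ => (hw i).integrable_normSq,
    fun x => Finset.sum_nonneg fun i _ => Complex.normSq_nonneg _, ?_, hw none,
    fun x => Finset.single_le_sum (f := fun i => Complex.normSq (w i x))
      (fun i _ => Complex.normSq_nonneg _) (Finset.mem_univ none), fun x => ?_, fun G => ?_⟩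
  · beta_reduce
    by_cases hx : x ∈ U
    · rw [indicator_of_mem hx, indicator_of_mem hx]; ring
    · rw [indicator_of_notMem hx, indicator_of_notMem hx, neg_zero]
  · let G : testForms n U := ⟨Pi.single l g, isTest_single hg l⟩
    have hG : divForm n G.1 = wd n Complex.I l g := divForm_single l
    have h1 := hVG G
    rw [hG] at h1
    rw [h1, hwl G, Fintype.sum_option, Fintype.sum_prod_type]
    have h2 : ∫ x, w none x * J none G x = ∫ x, w none x * (b x * wd n Complex.I l g x) := by
      simp only [hJ0, hG]
    rw [h2, add_sub_cancel_left]
    set P : Fin n → (Fin n → ℂ) → ℂ := fun j x =>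
      wd n (-Complex.I) j (fun y => (Real.exp (s y) : ℂ) * g y) x with hP
    have hPc : ∀ j, MemLp (fun x => c x * P j x) 2 volume := fun j =>
      (hcc.mul (contDiff_wd (m := 1) (hes.mul hg.contDiff_two) (by norm_num)).continuous
        ).memLp_of_hasCompactSupport (HasCompactSupport.wd hg.2.1.mul_left).mul_left
    have hi : ∀ i j, Integrable fun x => w i x * (c x * P j x) := fun i j =>
      (hw i).integrable_mul (hPc j)
    have h3 : ∀ j k, ∫ x, w (some (j, k)) x * J (some (j, k)) G x
        = (if k = l then ∫ x, w (some (j, k)) x * (c x * P j x) else 0)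
          - if j = l then ∫ x, w (some (j, k)) x * (c x * P k x) else 0 := fun j k => by
      have h4 : ∀ x, J (some (j, k)) G x
          = c x * ((if k = l then P j x else 0) - if j = l then P k x else 0) := fun x => by
        rw [hJ1, wd_mul_single, wd_mul_single]
      simp only [h4]
      split_ifs with hk hj hj
      · rw [← integral_sub (hi _ _) (hi _ _)]
        refine integral_congr_ae (Filter.Eventually.of_forall fun x => ?_)
        simp only
        ring
      · simp
      · rw [zero_sub, ← integral_neg]
        refine integral_congr_ae (Filter.Eventually.of_forall fun x => ?_)
        simp only
        ring
      · simp
    simp only [h3, Finset.sum_sub_distrib, Finset.sum_ite_eq', Finset.mem_univ, if_true]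
    rw [Finset.sum_comm (f := fun j k => if j = l then _ else _)]
    simp only [Finset.sum_ite_eq', Finset.mem_univ, if_true]
    rw [← Finset.sum_sub_distrib]
    refine Finset.sum_congr rfl fun j _ => ?_
    rw [← integral_sub (hi _ _) (hi _ _)]
    refine integral_congr_ae (Filter.Eventually.of_forall fun x => ?_)
    simp only
    have h5 : P j x = (Real.exp (s x) : ℂ) * (wd n (-Complex.I) j g x
        + wd n (-Complex.I) j (fun y => (s y : ℂ)) x * g x) := by
      have h6 := wd_exp (n := n) (c := -Complex.I) (j := j) (hs' x)
      simp only [← Complex.ofReal_exp] at h6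
      rw [hP]
      simp only
      rw [wd_mul (hes.differentiable (by norm_num) x)
        (hg.contDiff_two.differentiable (by norm_num) x), h6]
      ring
    by_cases hx : x ∈ U
    · rw [indicator_of_mem hx, h5]; ring
    · have h7 : x ∉ tsupport g := fun h => hx (hg.2.2 h)
      rw [h5, wd_eq_zero_of_notMem h7, image_eq_zero_of_notMem_tsupport h7]
      ring
  · rwa [integral_finsetSum _ fun i _ => (hw i).integrable_normSq]
  · have h0 : 0 ≤ Real.exp (2 * s x - φ x) := (Real.exp_pos _).le
    have h1 : ∑ p : Fin n × Fin n, Complex.normSq (w (some p) x)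
        ≤ ∑ i, Complex.normSq (w i x) := by
      rw [Fintype.sum_option]
      linarith [Complex.normSq_nonneg (w none x)]
    have h2 : ∀ j l, Complex.normSq (U.indicator (fun x => (c x * (Real.exp (s x) : ℂ))
        * (w (some (j, l)) x - w (some (l, j)) x)) x) ≤ Real.exp (2 * s x - φ x)
          * (Complex.normSq (w (some (j, l)) x) + Complex.normSq (w (some (l, j)) x)) := by
      intro j l
      by_cases hx : x ∈ U
      · rw [indicator_of_mem hx, Complex.normSq_mul, Complex.normSq_mul, hcn,
          Complex.normSq_ofReal]
        have h3 : Real.exp (-φ x) / 2 * (Real.exp (s x) * Real.exp (s x))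
            = Real.exp (2 * s x - φ x) / 2 := by
          rw [div_mul_eq_mul_div, ← Real.exp_add, ← Real.exp_add]
          congr 2
          ring
        have h4 : Complex.normSq (w (some (j, l)) x - w (some (l, j)) x)
            ≤ 2 * (Complex.normSq (w (some (j, l)) x) + Complex.normSq (w (some (l, j)) x)) := by
          have := Complex.normSq_nonneg (w (some (j, l)) x + w (some (l, j)) x)
          simp only [Complex.normSq_apply, Complex.sub_re, Complex.sub_im, Complex.add_re,
            Complex.add_im] at this ⊢
          nlinarith
        rw [h3]
        nlinarith
      · rw [indicator_of_notMem hx, map_zero]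
        exact mul_nonneg h0 (add_nonneg (Complex.normSq_nonneg _) (Complex.normSq_nonneg _))
    refine (Finset.sum_le_sum fun l _ => Finset.sum_le_sum fun j _ => h2 j l).trans ?_
    simp only [← Finset.mul_sum, Finset.sum_add_distrib]
    rw [Finset.sum_comm]
    rw [Fintype.sum_prod_type] at h1
    nlinarith
  · rw [hVG G, sub_add_cancel]

end TwistedRepresentation

section DualEstimate

variable {n : ℕ}

lemma dual_estimate_of_weights {U : Set (Fin n → ℂ)} (hU : IsOpen U)
    (hUb : Bornology.IsBounded U) {ψ f χ : (Fin n → ℂ) → ℝ} (hψ : ContDiff ℝ 2 ψ)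
    (hf : ContDiff ℝ 2 f) {E : ℝ} (hE : 0 < E)
    (h1 : ∀ x ∈ U, ∀ ξ, 3 * Complex.normSq (delPair n ψ x ξ) ≤ hessC n ψ x ξ)
    (h2 : ∀ x ∈ U, ∀ ξ, E * enormSq n ξ ≤ hessC n ψ x ξ)
    (h3 : ∀ x ∈ U, ∀ ξ, 0 ≤ hessC n f x ξ)
    {A : Fin n → (Fin n → ℂ) → ℂ} {u : (Fin n → ℂ) → ℂ} (hA : ∀ j, MemLp (A j) 2 volume)
    (hu : MemLp u 2 volume)
    (hAu : ∀ l g, IsTest n U g → ∫ x, A l x * g x = -∫ x, u x * wd n Complex.I l g x)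
    (hsc : ∀ j, HasCompactSupport (wd n (-Complex.I) j fun y => (wtTwist n ψ f y : ℂ)))
    (hχ : ContDiff ℝ 2 χ) (hχc : HasCompactSupport χ) (hχU : tsupport χ ⊆ U)
    (G : testForms n U) (hGχ : ∀ l x, G.1 l x = χ x * G.1 l x)
    (hf0 : ∀ x l, x ∈ tsupport (G.1 l) → f x ≤ 0) {L B : ℝ}
    (hfL : ∀ x j, wd n (-Complex.I) j (fun y => (χ y : ℂ)) x ≠ 0 → L ≤ f x)
    (hB : ∀ x, Real.exp (-ψ x)
      * ∑ j, Complex.normSq (wd n (-Complex.I) j (fun y => (χ y : ℂ)) x) ≤ B) :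
    Complex.normSq (pairLin n U A hA G)
      ≤ 32 * (∫ x, Real.exp (ψ x) * ∑ l, Complex.normSq (G.1 l x))
          * (B * (Real.exp 1 / E * ∑ j, ∫ x, Complex.normSq (A j x))) * Real.exp (-Real.exp L)
        + 6 * (Real.exp 1 / E * ∑ j, ∫ x, Complex.normSq (A j x))
          * ∫ x, Complex.normSq (divForm n G.1 x) := by
  have hs := contDiff_wtTwist hψ hf
  have hφ := (contDiff_wtMain hψ hf).continuous
  have ha := (contDiff_wtMult hf).continuous
  have hGc : ∀ (H : testForms n U) l, Continuous (H.1 l) := fun H l => (H.2 l).1.continuous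
  have hsupp : ∀ (H : testForms n U) x, x ∉ ⋃ l, tsupport (H.1 l) → ∀ l, H.1 l x = 0 :=
    fun H x hx l => image_eq_zero_of_notMem_tsupport fun h => hx (mem_iUnion.2 ⟨l, h⟩)
  have hint : ∀ (H : testForms n U) {p : (Fin n → ℂ) → ℝ}, Continuous p →
      Integrable fun x => p x * ∑ l, Complex.normSq (H.1 l x) := fun H p hp => by
    refine (hp.mul (continuous_finsetSum _ fun l _ => Complex.continuous_normSq.comp (hGc H l))
      ).integrable_of_hasCompactSupport ?_
    refine HasCompactSupport.intro (isCompact_iUnion fun l => (H.2 l).2.1) fun x hx => ?_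
    simp [hsupp H x hx]
  have hest : ∀ H : testForms n U, ∫ x, ∑ j, Complex.normSq (H.1 j x)
      ≤ Real.exp 1 / E * ∫ x, ((1 / 2) * (∑ j, ∑ k, Complex.normSq
          (wd n (-Complex.I) j (fun y => (Real.exp (wtTwist n ψ f y) : ℂ) * H.1 k y) x
            - wd n (-Complex.I) k (fun y => (Real.exp (wtTwist n ψ f y) : ℂ) * H.1 j y) x))
          * Real.exp (-wtMain n ψ f x)
          + 3 * wtMult n f x * Complex.normSq (divForm n H.1 x)) := fun H => by
    refine le_trans ?_ (mul_le_mul_of_nonneg_left (weighted_estimate hψ hf h1 h2 h3 H.2)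
      (div_pos (Real.exp_pos 1) hE).le)
    rw [← integral_const_mul]
    have i1 := hint H (p := fun _ => 1) continuous_const
    have i2 := hint H (p := fun x => Real.exp 1 * wtMult n f x) (continuous_const.mul ha)
    simp only [one_mul] at i1
    have e : (fun x => Real.exp 1 / E * (E * (∑ j, Complex.normSq (H.1 j x)) * wtMult n f x))
        = fun x => Real.exp 1 * wtMult n f x * ∑ j, Complex.normSq (H.1 j x) := by
      funext x
      field_simp
    rw [e]
    refine integral_mono i1 i2 fun x => ?_
    have h5 := mul_le_mul_of_nonneg_left (exp_neg_one_le_wtMult (f := f) x) (Real.exp_pos 1).le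
    rw [← Real.exp_add, add_neg_cancel, Real.exp_zero] at h5
    exact le_mul_of_one_le_left (Finset.sum_nonneg fun j _ => Complex.normSq_nonneg _) h5
  obtain ⟨V, w₀, Z, ω, hV, hZ, hZ2, hanti, heq, hω, hω0, hωC, hw, hwω, hZω, hrep⟩ :=
    exists_twisted_representation hUb hU.measurableSet hA hu hAu hs hφ ha
      (fun x => (wtMult_pos x).le) (div_pos (Real.exp_pos 1) hE).le hest
  set M := Real.exp 1 / E * ∑ j, ∫ x, Complex.normSq (A j x) with hM
  have hM0 : 0 ≤ M := mul_nonneg (div_pos (Real.exp_pos 1) hE).le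
    (Finset.sum_nonneg fun j _ => integral_nonneg fun x => Complex.normSq_nonneg _)
  have hB0 : 0 ≤ B := le_trans (mul_nonneg (Real.exp_pos _).le
    (Finset.sum_nonneg fun j _ => Complex.normSq_nonneg _)) (hB 0)
  have hf1 : ∀ x l, x ∈ tsupport (G.1 l) →
      Real.exp (2 * f x) ≤ Real.exp (f x) := fun x l hx =>
    Real.exp_le_exp.2 (by linarith [hf0 x l hx])
  -- the part supported away from the set where the cut-off is constant
  have hfirst : Complex.normSq (∫ x, V x * divForm n G.1 x)
      ≤ (∫ x, Real.exp (ψ x) * ∑ l, Complex.normSq (G.1 l x))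
        * (16 * (B * Real.exp (-Real.exp L)) * M) := by
    refine (weak_caccioppoli hU hV hZ hZ2 hanti hs hsc heq hχ hχc hχU G.2 hGχ).trans ?_
    refine mul_le_mul ?_ ?_ ?_ ?_
    · refine integral_mono (hint G (Real.continuous_exp.comp hs.continuous))
        (hint G (Real.continuous_exp.comp hψ.continuous)) fun x => ?_
      by_cases hx : x ∈ ⋃ l, tsupport (G.1 l)
      · obtain ⟨l, hl⟩ := mem_iUnion.1 hx
        refine mul_le_mul_of_nonneg_right (Real.exp_le_exp.2 ?_)
          (Finset.sum_nonneg fun l _ => Complex.normSq_nonneg _)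
        rw [wtTwist]
        linarith [hf1 x l hl]
      · simp [hsupp G x hx]
    · have h6 : ∀ x, (∑ l, ∑ j, Complex.normSq (Z j l x)) * (Real.exp (-wtTwist n ψ f x)
          * (8 * ∑ j, Complex.normSq (wd n (-Complex.I) j (fun y => (χ y : ℂ)) x)))
          ≤ 16 * (B * Real.exp (-Real.exp L)) * ω x := fun x => by
        by_cases hx : ∀ j, wd n (-Complex.I) j (fun y => (χ y : ℂ)) x = 0
        · simp only [hx, map_zero, Finset.sum_const_zero, mul_zero]
          exact mul_nonneg (mul_nonneg (by norm_num) (mul_nonneg hB0 (Real.exp_pos _).le)) (hω0 x)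
        · push Not at hx
          obtain ⟨i, hi⟩ := hx
          have hL := Real.exp_le_exp.2 (neg_le_neg (Real.exp_le_exp.2 (hfL x i hi)))
          set q := ∑ j, Complex.normSq (wd n (-Complex.I) j (fun y => (χ y : ℂ)) x) with hq
          have hq0 : 0 ≤ q := Finset.sum_nonneg fun j _ => Complex.normSq_nonneg _
          have h7 : Real.exp (2 * wtTwist n ψ f x - wtMain n ψ f x)
              * Real.exp (-wtTwist n ψ f x) = Real.exp (-ψ x) * Real.exp (-Real.exp (f x)) := by
            rw [← Real.exp_add, ← Real.exp_add, wtTwist, wtMain]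
            congr 1
            ring
          calc _ ≤ (2 * Real.exp (2 * wtTwist n ψ f x - wtMain n ψ f x) * ω x)
                * (Real.exp (-wtTwist n ψ f x) * (8 * q)) :=
                mul_le_mul_of_nonneg_right (hZω x)
                  (mul_nonneg (Real.exp_pos _).le (by linarith))
            _ = 16 * ω x * q * (Real.exp (2 * wtTwist n ψ f x - wtMain n ψ f x)
                * Real.exp (-wtTwist n ψ f x)) := by ring
            _ = 16 * ω x * ((Real.exp (-ψ x) * q) * Real.exp (-Real.exp (f x))) := by
                rw [h7]; ring
            _ ≤ 16 * ω x * (B * Real.exp (-Real.exp L)) :=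
                mul_le_mul_of_nonneg_left (mul_le_mul (hB x) hL (Real.exp_pos _).le hB0)
                  (by linarith [hω0 x])
            _ = _ := by ring
      refine (integral_mono_of_nonneg (Filter.Eventually.of_forall fun x => ?_)
        (hω.const_mul _) (Filter.Eventually.of_forall h6)).trans ?_
      · exact mul_nonneg (Finset.sum_nonneg fun l _ => Finset.sum_nonneg fun j _ =>
          Complex.normSq_nonneg _) (mul_nonneg (Real.exp_pos _).le (mul_nonneg (by norm_num)
          (Finset.sum_nonneg fun j _ => Complex.normSq_nonneg _)))
      · rw [integral_const_mul]
        exact mul_le_mul_of_nonneg_left hωC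
          (mul_nonneg (by norm_num) (mul_nonneg hB0 (Real.exp_pos _).le))
    · exact integral_nonneg fun x => mul_nonneg (Finset.sum_nonneg fun l _ =>
        Finset.sum_nonneg fun j _ => Complex.normSq_nonneg _) (mul_nonneg (Real.exp_pos _).le
        (mul_nonneg (by norm_num) (Finset.sum_nonneg fun j _ => Complex.normSq_nonneg _)))
    · exact integral_nonneg fun x => mul_nonneg (Real.exp_pos _).le
        (Finset.sum_nonneg fun l _ => Complex.normSq_nonneg _)
  have hdiv2 : Integrable fun x => Complex.normSq (divForm n G.1 x) :=
    ((continuous_divForm G).memLp_of_hasCompactSupport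
      (hasCompactSupport_divForm G)).integrable_normSq
  have hbc : Continuous fun x => (√(3 * wtMult n f x) : ℂ) := Complex.continuous_ofReal.comp
    (Real.continuous_sqrt.comp (continuous_const.mul ha))
  have hsecond : Complex.normSq (∫ x, w₀ x * ((√(3 * wtMult n f x) : ℂ) * divForm n G.1 x))
      ≤ M * (3 * ∫ x, Complex.normSq (divForm n G.1 x)) := by
    have hd : MemLp (fun x => (√(3 * wtMult n f x) : ℂ) * divForm n G.1 x) 2 volume :=
      (hbc.mul (continuous_divForm G)).memLp_of_hasCompactSupport
        (hasCompactSupport_divForm G).mul_left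
    have hi : Integrable fun x => w₀ x * ((√(3 * wtMult n f x) : ℂ) * divForm n G.1 x) :=
      hw.integrable_mul hd
    rw [← integral_const_mul]
    refine (normSq_integral_le hω (hdiv2.const_mul 3) hi hω0
      (fun x => mul_nonneg (by norm_num) (Complex.normSq_nonneg _)) fun x => ?_).trans
      (mul_le_mul_of_nonneg_right hωC (integral_nonneg fun x =>
        mul_nonneg (by norm_num) (Complex.normSq_nonneg _)))
    rw [Complex.normSq_mul, Complex.normSq_mul, Complex.normSq_ofReal,
      Real.mul_self_sqrt (mul_nonneg (by norm_num) (wtMult_pos x).le)]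
    refine mul_le_mul (hwω x) ?_ (mul_nonneg (mul_nonneg (by norm_num) (wtMult_pos x).le)
      (Complex.normSq_nonneg _)) (hω0 x)
    by_cases hx : x ∈ ⋃ l, tsupport (G.1 l)
    · obtain ⟨l, hl⟩ := mem_iUnion.1 hx
      refine mul_le_mul_of_nonneg_right ?_ (Complex.normSq_nonneg _)
      have h8 : wtMult n f x ≤ 1 := by
        rw [wtMult]
        exact Real.exp_le_one_iff.2 (by linarith [hf1 x l hl, Real.exp_pos (f x)])
      linarith
    · have h9 : divForm n G.1 x = 0 := Finset.sum_eq_zero fun l _ =>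
        wd_eq_zero_of_notMem fun h => hx (mem_iUnion.2 ⟨l, h⟩)
      simp [h9]
  have h12 : ∀ a b : ℂ,
      Complex.normSq (a + b) ≤ 2 * (Complex.normSq a + Complex.normSq b) := fun a b => by
    have := Complex.normSq_nonneg (a - b)
    simp only [Complex.normSq_apply, Complex.add_re, Complex.add_im, Complex.sub_re,
      Complex.sub_im] at this ⊢
    linarith
  rw [hrep G]
  refine (h12 _ _).trans ?_
  linarith

end DualEstimate

section PseudoconvexDomain

variable {n : ℕ}

lemma exists_cutoff {K Ω : Set (Fin n → ℂ)} (hK : IsCompact K) (hΩ : IsOpen Ω) (h : K ⊆ Ω) :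
    ∃ χ : (Fin n → ℂ) → ℝ, ContDiff ℝ 2 χ ∧ HasCompactSupport χ ∧ tsupport χ ⊆ Ω ∧
      ∃ W, IsOpen W ∧ K ⊆ W ∧ ∀ x ∈ W, χ x = 1 := by
  obtain ⟨L, hL, hKL, hLΩ⟩ := exists_compact_between hK hΩ h
  obtain ⟨M, hM, hLM, hMΩ⟩ := exists_compact_between hL hΩ hLΩ
  obtain ⟨χ, hχ, -, hs, h1⟩ := exists_contMDiff_support_eq_eq_one_iff (n := 2)
    (modelWithCornersSelf ℝ (Fin n → ℂ)) isOpen_interior hL.isClosed hLM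
  have ht : tsupport χ ⊆ M :=
    closure_minimal (hs.subset.trans interior_subset) hM.isClosed
  exact ⟨χ, hχ.contDiff, hM.of_isClosed_subset (isClosed_tsupport χ) ht, ht.trans hMΩ,
    interior L, isOpen_interior, hKL, fun x hx => (h1 x).1 (interior_subset hx)⟩

lemma contDiff_cutoff_mul {Ω : Set (Fin n → ℂ)} (hΩ : IsOpen Ω) {κ g : (Fin n → ℂ) → ℝ}
    (hκ : ContDiff ℝ 2 κ) (hκΩ : tsupport κ ⊆ Ω) (hg : ContDiffOn ℝ 2 g Ω) :
    ContDiff ℝ 2 fun x => κ x * g x := by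
  refine contDiff_iff_contDiffAt.2 fun x => ?_
  by_cases hx : x ∈ tsupport κ
  · exact hκ.contDiffAt.mul (hg.contDiffAt (hΩ.mem_nhds (hκΩ hx)))
  · refine (contDiffAt_const (c := (0 : ℝ))).congr_of_eventuallyEq ?_
    filter_upwards [(isClosed_tsupport κ).isOpen_compl.mem_nhds hx] with y hy
    rw [image_eq_zero_of_notMem_tsupport hy, zero_mul]

lemma hessC_add_const {f : (Fin n → ℂ) → ℝ} (hf : ContDiff ℝ 2 f) (c : ℝ) (z ξ : Fin n → ℂ) :
    hessC n (fun x => f x + c) z ξ = hessC n f z ξ := by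
  rw [hessC_add hf contDiff_const, add_eq_left]
  simp [hessC, iteratedFDeriv_const_of_ne (two_ne_zero)]

/-- The dual form of the solvability of `∂̄v = A` with an `L²` bound. -/
lemma dual_estimate {Ω : Set (Fin n → ℂ)} (hΩ : IsOpen Ω) (hpsc : Pseudoconvex n Ω)
    {ψ : (Fin n → ℂ) → ℝ} (hψ : ContDiffOn ℝ 2 ψ Ω) {E : ℝ} (hE : 0 < E)
    (h1 : ∀ x ∈ Ω, ∀ ξ, 3 * Complex.normSq (delPair n ψ x ξ) ≤ hessC n ψ x ξ)
    (h2 : ∀ x ∈ Ω, ∀ ξ, E * enormSq n ξ ≤ hessC n ψ x ξ)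
    {A : Fin n → (Fin n → ℂ) → ℂ} {u : (Fin n → ℂ) → ℂ} (hA : ∀ j, MemLp (A j) 2 volume)
    (hu : MemLp u 2 volume)
    (hAu : ∀ l g, IsTest n Ω g → ∫ x, A l x * g x = -∫ x, u x * wd n Complex.I l g x)
    (G : testForms n Ω) :
    Complex.normSq (pairLin n Ω A hA G)
      ≤ 6 * (Real.exp 1 / E * ∑ j, ∫ x, Complex.normSq (A j x))
          * ∫ x, Complex.normSq (divForm n G.1 x) := by
  obtain ⟨Φ, hΦ, hpsh, hexh⟩ := hpsc
  have hΦ2 : ContDiffOn ℝ 2 Φ Ω := contDiffOn_infty.1 hΦ 2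
  have hK₀ : IsCompact (⋃ l, tsupport (G.1 l)) := isCompact_iUnion fun l => (G.2 l).2.1
  have hK₀Ω : (⋃ l, tsupport (G.1 l)) ⊆ Ω := iUnion_subset fun l => (G.2 l).2.2
  obtain ⟨c, hc⟩ := hK₀.bddAbove_image (hΦ.continuousOn.mono hK₀Ω)
  have hc' : ∀ x ∈ ⋃ l, tsupport (G.1 l), Φ x ≤ c := fun x hx => hc (mem_image_of_mem Φ hx)
  obtain ⟨hK₁, hK₁Ω⟩ := hexh (c + 1)
  have hK₀₁ : (⋃ l, tsupport (G.1 l)) ⊆ closure {z ∈ Ω | Φ z < c + 1} := fun x hx =>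
    subset_closure ⟨hK₀Ω hx, by linarith [hc' x hx]⟩
  obtain ⟨χ, hχ, hχc, hχΩ, W, hW, hKW, hχ1⟩ := exists_cutoff hK₁ hΩ hK₁Ω
  obtain ⟨κ, hκ, hκc, hκΩ, U, hU, hχU, hκ1⟩ := exists_cutoff hχc hΩ hχΩ
  have hκU : ∀ x ∈ U, κ =ᶠ[nhds x] fun _ => 1 := fun x hx => by
    filter_upwards [hU.mem_nhds hx] with y hy using hκ1 y hy
  have hUκ : U ⊆ tsupport κ := fun x hx => subset_tsupport κ (by simp [hκ1 x hx])
  have hUΩ : U ⊆ Ω := hUκ.trans hκΩ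
  have hK₀U : (⋃ l, tsupport (G.1 l)) ⊆ U := fun x hx =>
    hχU (subset_tsupport χ (by simp [hχ1 x (hKW (hK₀₁ hx))]))
  have hψ' := contDiff_cutoff_mul hΩ hκ hκΩ hψ
  have hΦ' := contDiff_cutoff_mul hΩ hκ hκΩ hΦ2
  have hΦc := contDiff_cutoff_mul hΩ hκ hκΩ (hΦ2.sub (contDiffOn_const (c := c)))
  have hψU : ∀ x ∈ U, (fun y => κ y * ψ y) =ᶠ[nhds x] ψ := fun x hx => by
    filter_upwards [hκU x hx] with y hy
    rw [hy, one_mul]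
  have hΦU : ∀ x ∈ U, (fun y => κ y * Φ y) =ᶠ[nhds x] Φ := fun x hx => by
    filter_upwards [hκU x hx] with y hy
    rw [hy, one_mul]
  have hΦcU : ∀ x ∈ U, (fun y => κ y * (Φ y - c)) =ᶠ[nhds x] fun y => κ y * Φ y + -c :=
    fun x hx => by
      filter_upwards [hκU x hx] with y hy
      rw [hy]
      ring
  let G' : testForms n U := ⟨G.1, fun l =>
    ⟨(G.2 l).1, (G.2 l).2.1, (subset_iUnion (fun l => tsupport (G.1 l)) l).trans hK₀U⟩⟩
  have hχC : ContDiff ℝ 2 fun y => (χ y : ℂ) := Complex.ofRealCLM.contDiff.comp hχ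
  have hχs : HasCompactSupport fun y => (χ y : ℂ) := hχc.comp_left Complex.ofReal_zero
  have hχt : tsupport (fun y => (χ y : ℂ)) ⊆ tsupport χ :=
    closure_mono (Function.support_comp_subset Complex.ofReal_zero χ)
  obtain ⟨B, hB⟩ : ∃ B, ∀ x, Real.exp (-(κ x * ψ x))
      * ∑ j, Complex.normSq (wd n (-Complex.I) j (fun y => (χ y : ℂ)) x) ≤ B := by
    have hcont : Continuous fun x => Real.exp (-(κ x * ψ x))
        * ∑ j, Complex.normSq (wd n (-Complex.I) j (fun y => (χ y : ℂ)) x) :=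
      (Real.continuous_exp.comp hψ'.continuous.neg).mul (continuous_finsetSum _ fun j _ =>
        Complex.continuous_normSq.comp (contDiff_wd (m := 1) hχC (by norm_num)).continuous)
    have hcs : HasCompactSupport fun x => Real.exp (-(κ x * ψ x))
        * ∑ j, Complex.normSq (wd n (-Complex.I) j (fun y => (χ y : ℂ)) x) :=
      HasCompactSupport.intro hχs fun x hx => by simp [wd_eq_zero_of_notMem hx]
    obtain ⟨B, hB⟩ := hcs.exists_bound_of_continuous hcont
    exact ⟨B, fun x => (le_abs_self _).trans (hB x)⟩
  have key : ∀ L : ℝ, 0 ≤ L → Complex.normSq (pairLin n Ω A hA G)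
      ≤ 32 * (∫ x, Real.exp (κ x * ψ x) * ∑ l, Complex.normSq (G.1 l x))
          * (B * (Real.exp 1 / E * ∑ j, ∫ x, Complex.normSq (A j x))) * Real.exp (-Real.exp L)
        + 6 * (Real.exp 1 / E * ∑ j, ∫ x, Complex.normSq (A j x))
          * ∫ x, Complex.normSq (divForm n G.1 x) := fun L hL => by
    refine dual_estimate_of_weights hU (hκc.isBounded.subset hUκ) hψ'
      (f := fun x => L * (κ x * (Φ x - c))) (contDiff_const.mul hΦc) hE
      (fun x hx ξ => ?_) (fun x hx ξ => ?_) (fun x hx ξ => ?_) hA hu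
      (fun l g hg => hAu l g ⟨hg.1, hg.2.1, hg.2.2.trans hUΩ⟩) (fun j => ?_) hχ hχc hχU G'
      (fun l x => ?_) (fun x l hx => ?_) (fun x j hx => ?_) hB
    · rw [delPair_congr (hψU x hx), hessC_congr (hψU x hx)]
      exact h1 x (hUΩ hx) ξ
    · rw [hessC_congr (hψU x hx)]
      exact h2 x (hUΩ hx) ξ
    · rw [hessC_const_mul L hΦc, hessC_congr (hΦcU x hx), hessC_add_const hΦ',
        hessC_congr (hΦU x hx)]
      exact mul_nonneg hL (hpsh x (hUΩ hx) ξ)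
    · refine HasCompactSupport.intro hκc fun x hx => ?_
      rw [wd_congr (G := fun _ => 0), wd_const]
      filter_upwards [(isClosed_tsupport κ).isOpen_compl.mem_nhds hx] with y hy
      simp [wtTwist, image_eq_zero_of_notMem_tsupport hy]
    · by_cases hx : x ∈ tsupport (G.1 l)
      · rw [hχ1 x (hKW (hK₀₁ (mem_iUnion.2 ⟨l, hx⟩))), Complex.ofReal_one, one_mul]
      · have h0 : G'.1 l x = 0 := image_eq_zero_of_notMem_tsupport hx
        rw [h0, mul_zero]
    · have hx' : x ∈ ⋃ l, tsupport (G.1 l) := mem_iUnion.2 ⟨l, hx⟩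
      have := hc' x hx'
      simp only [hκ1 x (hK₀U hx'), one_mul]
      exact mul_nonpos_of_nonneg_of_nonpos hL (by linarith)
    · have hx' : x ∈ U := hχU (hχt (by_contra fun h => hx (wd_eq_zero_of_notMem h)))
      have hΦx : c + 1 ≤ Φ x := by
        by_contra! hlt
        refine hx ?_
        rw [wd_congr (G := fun _ => 1), wd_const]
        filter_upwards [hW.mem_nhds (hKW (subset_closure ⟨hUΩ hx', hlt⟩))] with y hy
        rw [hχ1 y hy, Complex.ofReal_one]
      simp only [hκ1 x hx', one_mul]
      nlinarith
  have hlim : Filter.Tendsto (fun L : ℝ =>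
      32 * (∫ x, Real.exp (κ x * ψ x) * ∑ l, Complex.normSq (G.1 l x))
          * (B * (Real.exp 1 / E * ∑ j, ∫ x, Complex.normSq (A j x))) * Real.exp (-Real.exp L)
        + 6 * (Real.exp 1 / E * ∑ j, ∫ x, Complex.normSq (A j x))
          * ∫ x, Complex.normSq (divForm n G.1 x)) Filter.atTop
      (nhds (32 * (∫ x, Real.exp (κ x * ψ x) * ∑ l, Complex.normSq (G.1 l x))
          * (B * (Real.exp 1 / E * ∑ j, ∫ x, Complex.normSq (A j x))) * 0
        + 6 * (Real.exp 1 / E * ∑ j, ∫ x, Complex.normSq (A j x))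
          * ∫ x, Complex.normSq (divForm n G.1 x))) :=
    ((Real.tendsto_exp_neg_atTop_nhds_zero.comp Real.tendsto_exp_atTop).const_mul _).add_const _
  rw [mul_zero, zero_add] at hlim
  exact ge_of_tendsto hlim (Filter.eventually_atTop.2 ⟨0, key⟩)

end PseudoconvexDomain

section ClosedRange

variable {n : ℕ} {Ω : Set (Fin n → ℂ)}

lemma memLp_indicator (hΩ : IsOpen Ω) (f : Lp ℂ 2 (volume.restrict Ω)) :
    MemLp (Ω.indicator f) 2 (volume : Measure (Fin n → ℂ)) :=
  (memLp_indicator_iff_restrict hΩ.measurableSet).2 (Lp.memLp f)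

lemma integral_indicator_mul (hΩ : IsOpen Ω) (f g : (Fin n → ℂ) → ℂ) :
    ∫ x, Ω.indicator f x * g x = ∫ x in Ω, f x * g x := by
  rw [← integral_indicator hΩ.measurableSet]
  exact integral_congr_ae (Filter.Eventually.of_forall fun x =>
    (indicator_mul_left Ω f g).symm)

lemma integral_normSq_indicator (hΩ : IsOpen Ω) (f : Lp ℂ 2 (volume.restrict Ω)) :
    ∫ x, Complex.normSq (Ω.indicator f x) = ‖f‖ ^ 2 := by
  rw [← integral_normSq_eq_norm_sq, ← integral_indicator hΩ.measurableSet]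
  refine integral_congr_ae (Filter.Eventually.of_forall fun x => ?_)
  by_cases hx : x ∈ Ω <;> simp [hx]

lemma continuous_integral_mul_test {g : (Fin n → ℂ) → ℂ} (hg : IsTest n Ω g) :
    Continuous fun f : Lp ℂ 2 (volume.restrict Ω) => ∫ x in Ω, f x * g x := by
  have hm : MemLp (fun x => (starRingEnd ℂ) (g x)) 2 (volume.restrict Ω) :=
    (Complex.continuous_conj.comp hg.1.continuous).memLp_of_hasCompactSupport
      (hg.2.1.comp_left (map_zero _))
  have h : (fun f : Lp ℂ 2 (volume.restrict Ω) => ∫ x in Ω, f x * g x)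
      = fun f => inner ℂ hm.toLp f := by
    funext f
    rw [L2.inner_def]
    refine integral_congr_ae ?_
    filter_upwards [hm.coeFn_toLp] with x hx
    simp [hx]
  rw [h]
  exact continuous_const.inner continuous_id

lemma delPair_hessC_const_mul (hΩ : IsOpen Ω) {ψ : (Fin n → ℂ) → ℝ} (hψ : ContDiffOn ℝ 2 ψ Ω)
    (a : ℝ) {z : Fin n → ℂ} (hz : z ∈ Ω) (ξ : Fin n → ℂ) :
    delPair n (fun x => a * ψ x) z ξ = a * delPair n ψ z ξ ∧
      hessC n (fun x => a * ψ x) z ξ = a * hessC n ψ z ξ := by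
  have h := hψ.contDiffAt (hΩ.mem_nhds hz)
  refine ⟨delPair_const_mul a (h.differentiableAt two_ne_zero), ?_⟩
  have h2 : iteratedFDeriv ℝ 2 (fun x => a * ψ x) z = a • iteratedFDeriv ℝ 2 ψ z :=
    iteratedFDeriv_const_smul_apply (a := a) h
  simp only [hessC, h2, _root_.smul_apply, smul_eq_mul]
  ring

/-- Under the dual `L²` estimate, the equation `∂̄u = α` has a solution. -/
lemma exists_dbarEq_of_dual_estimate (hΩ : IsOpen Ω) (α : Fin n → Lp ℂ 2 (volume.restrict Ω))
    {C : ℝ} (h : ∀ G : testForms n Ω, Complex.normSq (∑ j, ∫ x in Ω, α j x * G.1 j x)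
      ≤ C * ∫ x, Complex.normSq (divForm n G.1 x)) (hC : 0 ≤ C) :
    ∃ u : Lp ℂ 2 (volume.restrict Ω), DbarEq n Ω u fun j => α j := by
  have hpair : ∀ G : testForms n Ω,
      pairLin n Ω (fun j => Ω.indicator (α j)) (fun j => memLp_indicator hΩ (α j)) G
        = ∑ j, ∫ x in Ω, α j x * G.1 j x := fun G => by
    change ∑ j, ∫ x, Ω.indicator (α j) x * G.1 j x = _
    exact Finset.sum_congr rfl fun j _ => integral_indicator_mul hΩ (α j) (G.1 j)
  obtain ⟨w, hw, -, hrep⟩ := exists_memLp_repr (μ := volume) (fun _ : Unit => divLin n Ω)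
    (fun _ G => (continuous_divForm G).memLp_of_hasCompactSupport (hasCompactSupport_divForm G))
    (pairLin n Ω (fun j => Ω.indicator (α j)) (fun j => memLp_indicator hΩ (α j)))
    (Real.sqrt_nonneg C) fun G => by
      rw [← Complex.normSq_eq_norm_sq, Real.sq_sqrt hC, hpair]
      simpa [divLin] using h G
  have hw' : MemLp (fun x => -w () x) 2 (volume.restrict Ω) := ((hw ()).restrict Ω).neg
  refine ⟨hw'.toLp, fun j φ hφ => ?_⟩
  have h1 := hrep ⟨Pi.single j φ, isTest_single hφ j⟩
  rw [hpair] at h1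
  simp only [divLin, LinearMap.coe_mk, AddHom.coe_mk, divForm_single, Finset.univ_unique,
    Finset.sum_singleton] at h1
  rw [Finset.sum_eq_single j (fun i _ hi => by simp [Pi.single_eq_of_ne hi]) (by simp)] at h1
  simp only [Pi.single_eq_same] at h1
  rw [h1, ← integral_neg]
  have h2 : ∫ x in Ω, -(hw'.toLp (fun x => -w () x) x * dbarCoord n φ j x)
      = ∫ x in Ω, w () x * wd n Complex.I j φ x := by
    refine integral_congr_ae ?_
    filter_upwards [hw'.coeFn_toLp] with x hx
    rw [hx, neg_mul, neg_neg]
    rfl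
  rw [h2, ← integral_indicator hΩ.measurableSet]
  refine integral_congr_ae (Filter.Eventually.of_forall fun x => ?_)
  by_cases hx : x ∈ Ω
  · simp [hx]
  · have h0 : wd n Complex.I j φ x = 0 := wd_eq_zero_of_notMem fun h => hx (hφ.2.2 h)
    simp [hx, h0]

end ClosedRange

/-- **Corollary 6.3 (q = 0).** If `Ω ⊆ ℂⁿ` is a pseudoconvex domain admitting a real-valued
`ψ ∈ C²(Ω)` and constants `D, E > 0` with `|⟨∂ψ(z),ξ⟩|² ≤ D²·Hψ(z;ξ)` (self-bounded
gradient) and `Hψ(z;ξ) ≥ E|ξ|²` for all `z ∈ Ω`, `ξ ∈ ℂⁿ`, then `∂̄` has closed range: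
`R(∂̄) = {α ∈ (L²(Ω))ⁿ : ∃u ∈ L²(Ω), ∂̄u = α}` is closed in `(L²(Ω))ⁿ`. -/
theorem closed_range_of_self_bounded_gradient
    {n : ℕ} (Ω : Set (Fin n → ℂ)) (hne : Ω.Nonempty) (hop : IsOpen Ω)
    (hconn : IsConnected Ω) (hpsc : Pseudoconvex n Ω)
    (ψ : (Fin n → ℂ) → ℝ) (hψ : ContDiffOn ℝ 2 ψ Ω)
    (D E : ℝ) (hD : 0 < D) (hE : 0 < E)
    (hself : ∀ z ∈ Ω, ∀ ξ : Fin n → ℂ,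
      Complex.normSq (delPair n ψ z ξ) ≤ D ^ 2 * hessC n ψ z ξ)
    (hhess : ∀ z ∈ Ω, ∀ ξ : Fin n → ℂ, E * enormSq n ξ ≤ hessC n ψ z ξ) :
    IsClosed {α : Fin n → Lp ℂ 2 ((volume : Measure (Fin n → ℂ)).restrict Ω) |
      ∃ u : Lp ℂ 2 ((volume : Measure (Fin n → ℂ)).restrict Ω),
        DbarEq n Ω (⇑u) (fun j => ⇑(α j))} := by
  set a : ℝ := 1 / (3 * D ^ 2) with ha
  have ha0 : 0 < a := by positivity
  have hEa : 0 < a * E := mul_pos ha0 hE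
  have h1 : ∀ x ∈ Ω, ∀ ξ, 3 * Complex.normSq (delPair n (fun x => a * ψ x) x ξ)
      ≤ hessC n (fun x => a * ψ x) x ξ := fun x hx ξ => by
    obtain ⟨e1, e2⟩ := delPair_hessC_const_mul hop hψ a hx ξ
    rw [e1, e2, Complex.normSq_mul, Complex.normSq_ofReal]
    calc 3 * (a * a * Complex.normSq (delPair n ψ x ξ))
        ≤ 3 * (a * a * (D ^ 2 * hessC n ψ x ξ)) := by
          have := hself x hx ξ
          gcongr
      _ = a * hessC n ψ x ξ := by
          rw [ha]
          field_simp
  have h2 : ∀ x ∈ Ω, ∀ ξ, a * E * enormSq n ξ ≤ hessC n (fun x => a * ψ x) x ξ :=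
    fun x hx ξ => by
      rw [(delPair_hessC_const_mul hop hψ a hx ξ).2, mul_assoc]
      exact mul_le_mul_of_nonneg_left (hhess x hx ξ) ha0.le
  have hset : {α : Fin n → Lp ℂ 2 ((volume : Measure (Fin n → ℂ)).restrict Ω) |
      ∃ u : Lp ℂ 2 ((volume : Measure (Fin n → ℂ)).restrict Ω),
        DbarEq n Ω (⇑u) (fun j => ⇑(α j))}
      = {α | ∀ G : testForms n Ω, Complex.normSq (∑ j, ∫ x in Ω, α j x * G.1 j x)
        ≤ 6 * (Real.exp 1 / (a * E) * ∑ j, ‖α j‖ ^ 2)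
          * ∫ x, Complex.normSq (divForm n G.1 x)} := by
    refine Subset.antisymm ?_ fun α hα =>
      exists_dbarEq_of_dual_estimate hop α hα (by positivity)
    rintro α ⟨u, hu⟩ G
    have h3 := dual_estimate hop hpsc (contDiffOn_const.mul hψ) hEa h1 h2
      (A := fun j => Ω.indicator (α j)) (u := Ω.indicator u)
      (fun j => memLp_indicator hop (α j)) (memLp_indicator hop u) (fun l g hg => by
        rw [integral_indicator_mul hop, integral_indicator_mul hop]
        exact hu l g hg) G
    simp only [integral_normSq_indicator hop] at h3
    refine le_trans (le_of_eq (congrArg _ ?_)) h3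
    exact Finset.sum_congr rfl fun j _ => (integral_indicator_mul hop _ _).symm
  rw [hset, ofPred_forall]
  refine isClosed_iInter fun G => isClosed_le ?_ ?_
  · exact Complex.continuous_normSq.comp (continuous_finsetSum _ fun j _ =>
      (continuous_integral_mul_test (G.2 j)).comp (continuous_apply j))
  · fun_prop
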